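/- Theorem 1.2(3): For every integer n ≥ 1, with h := ν₂(n): if n is even then lim_{r→0⁺} B_{4,n}(r) = 8·σ₁(n)·(2^h − 3)/(2^{h+1} − 1), and if n is odd then lim_{r→0⁺} B_{4,n}(r) = 0; moreover, for every n ≥ 1, lim_{r→0⁺} B̃_{4,n}(r) = 8·σ₁(n)·2^h/(2^{h+1} − 1). -/

import Mathlib

open Complex Real Filter Topology BigOperators MeasureTheory

noncomputable section

/-- `ee x = exp(2πix)`. -/
def ee (x : ℂ) : ℂ := Complex.exp (2 * (π : ℂ) * Complex.I * x)

/-- `ε_d`: equals 1 if `d ≡ 1 (mod 4)` and `i` if `d ≡ 3 (mod 4)`. -/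
def epsFactor (d : ℕ) : ℂ := if d % 4 = 1 then 1 else Complex.I

/-- Real-variable Kloosterman sum, even modulus `c`:
`K(t,n,c,ν_Θ^w) = Σ_a ε_{d_a}^w (2c/d_a)^w e((t a + n d_a)/(2c))`, the sum over `-c < a < c`
with `gcd(a,2c)=1` and `d_a` the inverse of `a` modulo `2c` in `(0,2c)`. -/
def RKe (t : ℝ) (n : ℤ) (c : ℕ) (w : ℕ) : ℂ :=
  ∑ a ∈ Finset.Ico (-(c : ℤ) + 1) (c : ℤ), ∑ d ∈ Finset.Ico 1 (2 * c),
    if (a * d) % (2 * (c : ℤ)) = 1 then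
      epsFactor d ^ w * ((jacobiSym (2 * (c : ℤ)) d : ℤ) : ℂ) ^ w *
        ee (((t * a + (n : ℝ) * d) / (2 * c) : ℝ) : ℂ)
    else 0

/-- Real-variable Kloosterman sum, odd modulus `c`:
`K̃(t,n,c,ν_Θ^w) = e(w/8) ε_c^{-w} Σ_b (-2c_b/c)^w e((t b - n c_b)/(2c))`, the sum over even
`-c < b < c` with `gcd(b,c)=1`, where `c_b` is the unique even integer in `[0,2c)` with
`b c_b ≡ -1 (mod c)`.  (For `c = 1` this gives `e(w/8)`.) -/
def RKo (t : ℝ) (n : ℤ) (c : ℕ) (w : ℕ) : ℂ :=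
  ee ((w : ℂ) / 8) * (epsFactor c)⁻¹ ^ w *
    ∑ b ∈ Finset.Ico (-(c : ℤ) + 1) (c : ℤ), ∑ cb ∈ Finset.range (2 * c),
      if b % 2 = 0 ∧ cb % 2 = 0 ∧ (b * cb) % (c : ℤ) = (-1) % (c : ℤ) then
        ((jacobiSym (-(2 * (cb : ℤ))) c : ℤ) : ℂ) ^ w *
          ee (((t * b - (n : ℝ) * cb) / (2 * c) : ℝ) : ℂ)
      else 0

/-- Bessel function of the first kind of order 1, via its power series. -/
def J1 (x : ℝ) : ℝ :=
  ∑' j : ℕ, (-1) ^ j * (x / 2) ^ (2 * j + 1) / ((j.factorial : ℝ) * (j + 1).factorial)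

/-- `B_{4,n}(r)`. -/
def B4 (n : ℕ) (r : ℝ) : ℂ :=
  (π : ℂ) * ((Real.sqrt n / |r| : ℝ) : ℂ) *
    ∑' c : ℕ, if Even c ∧ 0 < c then
      RKe (r ^ 2) n c 4 / (c : ℂ) * ((J1 (2 * π * |r| * Real.sqrt n / c) : ℝ) : ℂ)
    else 0

/-- `B̃_{4,n}(r)`. -/
def B4t (n : ℕ) (r : ℝ) : ℂ :=
  -(π : ℂ) * ((Real.sqrt n / |r| : ℝ) : ℂ) *
    ∑' c : ℕ, if Odd c then
      RKo (r ^ 2) n c 4 / (c : ℂ) * ((J1 (2 * π * |r| * Real.sqrt n / c) : ℝ) : ℂ)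
    else 0

/-- sum of positive divisors of `n` -/
def sigma1 (n : ℕ) : ℕ := ∑ d ∈ n.divisors, d

/-- A set of residues in `[0, q)` that are pairwise congruent modulo a divisor `D` of `q` has at
most `q / D` elements. -/
lemma card_le_div_of_pairwise_dvd {q D : ℕ} (hq : 0 < q) (hD : D ∣ q) (T : Finset ℕ)
    (hT : ∀ x ∈ T, x < q) (hdvd : ∀ x ∈ T, ∀ y ∈ T, (D : ℤ) ∣ (x : ℤ) - y) :
    T.card ≤ q / D := by
  have hD0 : 0 < D := Nat.pos_of_dvd_of_pos hD hq
  rw [← Finset.card_range (q / D)]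
  refine Finset.card_le_card_of_injOn (fun x => x / D) ?_ ?_
  · intro x hx
    have := hT x hx
    simp only [Finset.coe_range, Set.mem_Iio]
    exact Nat.div_lt_div_of_lt_of_dvd hD this
  · intro x hx y hy hxy
    have h1 : x % D = y % D :=
      (Nat.modEq_iff_dvd.mpr (hdvd y hy x hx))
    have h2 := Nat.div_add_mod x D
    have h3 := Nat.div_add_mod y D
    simp only at hxy
    rw [hxy, h1] at h2
    omega

/-- The number of pairs `(a, c)` modulo `q = d₁ d₂ d₃` with `c ≡ -1 (d₁)`, `a ≡ 1 (d₂)` and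
`a ≡ c (d₃)` is at most `2 q`. -/
lemma card_pairs_of_factorization {q d₁ d₂ d₃ : ℕ} (hq : 0 < q) (h : q = d₁ * (d₂ * d₃)) :
    (((Finset.range q ×ˢ Finset.range q).filter (fun p : ℕ × ℕ =>
      (d₁ : ℤ) ∣ (p.2 : ℤ) + 1 ∧ (d₂ : ℤ) ∣ (p.1 : ℤ) - 1 ∧ (d₃ : ℤ) ∣ (p.1 : ℤ) - p.2)).card)
      ≤ 2 * q := by
  set P := (Finset.range q ×ˢ Finset.range q).filter (fun p : ℕ × ℕ =>
      (d₁ : ℤ) ∣ (p.2 : ℤ) + 1 ∧ (d₂ : ℤ) ∣ (p.1 : ℤ) - 1 ∧ (d₃ : ℤ) ∣ (p.1 : ℤ) - p.2) with hP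
  rcases P.eq_empty_or_nonempty with he | ⟨p₀, hp₀⟩
  · simp [he]
  have hd1 : 0 < d₁ := Nat.pos_of_ne_zero (by rintro rfl; simp at h; omega)
  have hd2 : 0 < d₂ := Nat.pos_of_ne_zero (by rintro rfl; simp at h; omega)
  have hd3 : 0 < d₃ := Nat.pos_of_ne_zero (by rintro rfl; simp at h; omega)
  set g := Nat.gcd d₂ d₃ with hg
  have hg0 : 0 < g := Nat.gcd_pos_of_pos_left _ hd2
  have hgc : ∀ p ∈ P, (g : ℤ) ∣ (p.2 : ℤ) - 1 := by
    intro p hp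
    simp only [hP, Finset.mem_filter] at hp
    have h2 : (g : ℤ) ∣ (p.1 : ℤ) - 1 :=
      (Int.natCast_dvd_natCast.mpr (Nat.gcd_dvd_left d₂ d₃)).trans hp.2.2.1
    have h3 : (g : ℤ) ∣ (p.1 : ℤ) - p.2 :=
      (Int.natCast_dvd_natCast.mpr (Nat.gcd_dvd_right d₂ d₃)).trans hp.2.2.2
    have := dvd_sub h2 h3
    simpa using this
  have hgcd : Nat.gcd d₁ g ∣ 2 := by
    have h1 : ((Nat.gcd d₁ g : ℕ) : ℤ) ∣ (p₀.2 : ℤ) - 1 :=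
      (Int.natCast_dvd_natCast.mpr (Nat.gcd_dvd_right d₁ g)).trans (hgc p₀ hp₀)
    have h2 : ((Nat.gcd d₁ g : ℕ) : ℤ) ∣ (p₀.2 : ℤ) + 1 := by
      simp only [hP, Finset.mem_filter] at hp₀
      exact (Int.natCast_dvd_natCast.mpr (Nat.gcd_dvd_left d₁ g)).trans hp₀.2.1
    have := dvd_sub h2 h1
    have h3 : (p₀.2 : ℤ) + 1 - (p₀.2 - 1) = ((2 : ℕ) : ℤ) := by push_cast; ring
    rw [h3] at this
    exact Int.natCast_dvd_natCast.mp this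
  have hgcd2 : Nat.gcd d₁ g ≤ 2 := Nat.le_of_dvd (by norm_num) hgcd
  have hgl := Nat.gcd_mul_lcm d₂ d₃
  have hgl1 := Nat.gcd_mul_lcm d₁ g
  have hlq : Nat.lcm d₂ d₃ ∣ q := by
    rw [h]; exact (Nat.lcm_dvd_mul d₂ d₃).trans (Dvd.intro_left _ rfl)
  have hl1q : Nat.lcm d₁ g ∣ q := by
    rw [h]
    refine (Nat.lcm_dvd_mul d₁ g).trans (mul_dvd_mul_left _ ?_)
    exact (Nat.gcd_dvd_left d₂ d₃).trans (Dvd.intro _ rfl)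
  have hC : (P.image Prod.snd).card ≤ q / Nat.lcm d₁ g := by
    refine card_le_div_of_pairwise_dvd hq hl1q _ ?_ ?_
    · intro x hx
      simp only [hP, Finset.mem_image, Finset.mem_filter, Finset.mem_product,
        Finset.mem_range] at hx
      obtain ⟨p, hp, rfl⟩ := hx
      exact hp.1.2
    · intro x hx y hy
      obtain ⟨p, hp, rfl⟩ := Finset.mem_image.mp hx
      obtain ⟨r, hr, rfl⟩ := Finset.mem_image.mp hy
      rw [Int.natCast_dvd, Nat.lcm_dvd_iff, ← Int.natCast_dvd, ← Int.natCast_dvd]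
      constructor
      · have h1 := (Finset.mem_filter.mp hp).2.1
        have h2 := (Finset.mem_filter.mp hr).2.1
        simpa using dvd_sub h1 h2
      · simpa using dvd_sub (hgc p hp) (hgc r hr)
  have hA : ∀ c ∈ P.image Prod.snd, (P.filter (fun p => p.2 = c)).card ≤ q / Nat.lcm d₂ d₃ := by
    intro c _
    have hinj : (P.filter (fun p => p.2 = c)).card
        = ((P.filter (fun p => p.2 = c)).image Prod.fst).card := by
      rw [Finset.card_image_of_injOn]
      intro p hp r hr hpr
      simp only [Finset.coe_filter, Set.mem_ofPred_eq] at hp hr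
      exact Prod.ext hpr (hp.2.trans hr.2.symm)
    rw [hinj]
    refine card_le_div_of_pairwise_dvd hq hlq _ ?_ ?_
    · intro x hx
      simp only [hP, Finset.mem_image, Finset.mem_filter, Finset.mem_product,
        Finset.mem_range] at hx
      obtain ⟨p, hp, rfl⟩ := hx
      exact hp.1.1.1
    · intro x hx y hy
      obtain ⟨p, hp, rfl⟩ := Finset.mem_image.mp hx
      obtain ⟨r, hr, rfl⟩ := Finset.mem_image.mp hy
      obtain ⟨hp, hpc⟩ := Finset.mem_filter.mp hp
      obtain ⟨hr, hrc⟩ := Finset.mem_filter.mp hr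
      rw [Int.natCast_dvd, Nat.lcm_dvd_iff, ← Int.natCast_dvd, ← Int.natCast_dvd]
      constructor
      · have h1 := (Finset.mem_filter.mp hp).2.2.1
        have h2 := (Finset.mem_filter.mp hr).2.2.1
        simpa using dvd_sub h1 h2
      · have h1 := (Finset.mem_filter.mp hp).2.2.2
        have h2 := (Finset.mem_filter.mp hr).2.2.2
        rw [hpc] at h1
        rw [hrc] at h2
        simpa using dvd_sub h1 h2
  have hcard : P.card ≤ (q / Nat.lcm d₂ d₃) * (P.image Prod.snd).card :=
    Finset.card_le_mul_card_image_of_maps_to (fun p hp => Finset.mem_image_of_mem _ hp) _ hA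
  obtain ⟨A, hA'⟩ := hlq
  obtain ⟨C, hC'⟩ := hl1q
  have hl0 : 0 < Nat.lcm d₂ d₃ := Nat.lcm_pos hd2 hd3
  have hl1 : 0 < Nat.lcm d₁ g := Nat.lcm_pos hd1 hg0
  have eA : q / Nat.lcm d₂ d₃ = A := by
    conv_lhs => rw [hA']
    exact Nat.mul_div_cancel_left _ hl0
  have eC : q / Nat.lcm d₁ g = C := by
    conv_lhs => rw [hC']
    exact Nat.mul_div_cancel_left _ hl1
  rw [eA] at hcard
  rw [eC] at hC
  have key : A * C ≤ 2 * q := by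
    have e1 : A = d₁ * g := by
      have : Nat.lcm d₂ d₃ * A = Nat.lcm d₂ d₃ * (d₁ * g) := by
        rw [← hA', h, ← hgl]; ring
      exact Nat.eq_of_mul_eq_mul_left hl0 this
    have e2 : A * C = Nat.gcd d₁ g * q := by
      rw [e1, ← hgl1, hC']; ring
    rw [e2]
    exact Nat.mul_le_mul_right _ hgcd2
  calc P.card ≤ A * (P.image Prod.snd).card := hcard
    _ ≤ A * C := Nat.mul_le_mul_left _ hC
    _ ≤ 2 * q := key

/-- The number of pairs `(a, c)` modulo `q` with `(c + 1)(a - 1)(a - c) = 0` is at most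
`2 q τ(q)²`. -/
lemma card_pairs_mul_eq_zero (q : ℕ) [NeZero q] :
    ((Finset.univ : Finset (ZMod q × ZMod q)).filter
      (fun p => (p.2 + 1) * ((p.1 - 1) * (p.1 - p.2)) = 0)).card
      ≤ 2 * q * q.divisors.card ^ 2 := by
  have hq : 0 < q := Nat.pos_of_ne_zero (NeZero.ne q)
  set F : ℕ × ℕ → Finset (ℕ × ℕ) := fun d =>
    (Finset.range q ×ˢ Finset.range q).filter (fun p : ℕ × ℕ =>
      (d.1 : ℤ) ∣ (p.2 : ℤ) + 1 ∧ (d.2 : ℤ) ∣ (p.1 : ℤ) - 1 ∧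
        ((q / (d.1 * d.2) : ℕ) : ℤ) ∣ (p.1 : ℤ) - p.2) with hF
  set D := (q.divisors ×ˢ q.divisors).filter (fun d => d.1 * d.2 ∣ q) with hD
  have h1 : ((Finset.univ : Finset (ZMod q × ZMod q)).filter
      (fun p => (p.2 + 1) * ((p.1 - 1) * (p.1 - p.2)) = 0)).card ≤ (D.biUnion F).card := by
    refine Finset.card_le_card_of_injOn (fun p => (p.1.val, p.2.val)) ?_ ?_
    · rintro ⟨a, c⟩ hp
      simp only [Finset.coe_filter, Finset.mem_univ, true_and, Set.mem_ofPred_eq] at hp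
      have hz : (q : ℤ) ∣ ((c.val : ℤ) + 1) * (((a.val : ℤ) - 1) * ((a.val : ℤ) - c.val)) := by
        rw [← ZMod.intCast_zmod_eq_zero_iff_dvd]
        push_cast
        simpa using hp
      obtain ⟨x, y, hx, hy, hxy⟩ := exists_dvd_and_dvd_of_dvd_mul hz
      obtain ⟨z, w, hz, hw, rfl⟩ := exists_dvd_and_dvd_of_dvd_mul hy
      have hn : q = x.natAbs * (z.natAbs * w.natAbs) := by
        rw [← Int.natAbs_mul, ← Int.natAbs_mul, ← hxy, Int.natAbs_natCast]
      have hx0 : 0 < x.natAbs := Nat.pos_of_ne_zero (by intro h; rw [h] at hn; omega)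
      have hz0 : 0 < z.natAbs := Nat.pos_of_ne_zero (by intro h; rw [h] at hn; omega)
      simp only [Finset.coe_biUnion, Set.mem_iUnion]
      refine ⟨(x.natAbs, z.natAbs), ?_, ?_⟩
      · simp only [hD, Finset.coe_filter, Finset.mem_product, Nat.mem_divisors, Set.mem_ofPred_eq]
        refine ⟨⟨⟨⟨_, hn⟩, hq.ne'⟩, ⟨x.natAbs * w.natAbs, ?_⟩, hq.ne'⟩, w.natAbs, ?_⟩
        · rw [hn]; ring
        · rw [hn]; ring
      · have hdiv : q / (x.natAbs * z.natAbs) = w.natAbs := by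
          conv_lhs => rw [hn, ← mul_assoc]
          exact Nat.mul_div_cancel_left _ (Nat.mul_pos hx0 hz0)
        simp only [hF, Finset.coe_filter, Finset.mem_product, Finset.mem_range, Set.mem_ofPred_eq,
          hdiv]
        refine ⟨⟨ZMod.val_lt a, ZMod.val_lt c⟩, ?_, ?_, ?_⟩
        · exact Int.natAbs_dvd.mpr hx
        · exact Int.natAbs_dvd.mpr hz
        · exact Int.natAbs_dvd.mpr hw
    · rintro ⟨a, c⟩ _ ⟨a', c'⟩ _ h
      simp only [Prod.mk.injEq] at h
      exact Prod.ext (ZMod.val_injective q h.1) (ZMod.val_injective q h.2)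
  have h2 : (D.biUnion F).card ≤ D.card * (2 * q) := by
    refine Finset.card_biUnion_le_card_mul _ _ _ ?_
    rintro ⟨d₁, d₂⟩ hd
    simp only [hD, Finset.mem_filter] at hd
    refine card_pairs_of_factorization hq ?_
    rw [← mul_assoc]
    exact (Nat.mul_div_cancel' hd.2).symm
  have h3 : D.card ≤ q.divisors.card ^ 2 := by
    refine (Finset.card_filter_le _ _).trans ?_
    rw [Finset.card_product, sq]
  calc _ ≤ _ := h1
    _ ≤ _ := h2
    _ ≤ q.divisors.card ^ 2 * (2 * q) := Nat.mul_le_mul_right _ h3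
    _ = _ := by ring

/-- The classical Kloosterman sum `∑ₓ χ(m x + ν x⁻¹)` over units modulo `q`. -/
def kloosterman (q : ℕ) [NeZero q] (m ν : ZMod q) : ℂ :=
  ∑ x : (ZMod q)ˣ, ZMod.stdAddChar (m * (x : ZMod q) + ν * ((x⁻¹ : (ZMod q)ˣ) : ZMod q))

/-- The quadruples of units with equal sums and equal sums of inverses. -/
def unitQuads (q : ℕ) [NeZero q] :
    Finset (((ZMod q)ˣ × (ZMod q)ˣ) × ((ZMod q)ˣ × (ZMod q)ˣ)) :=
  Finset.univ.filter (fun p =>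
    ((p.1.1 : ZMod q) + (p.1.2 : ZMod q) - (p.2.1 : ZMod q) - (p.2.2 : ZMod q) = 0) ∧
      (((p.1.1⁻¹ : (ZMod q)ˣ) : ZMod q) + ((p.1.2⁻¹ : (ZMod q)ˣ) : ZMod q)
        - ((p.2.1⁻¹ : (ZMod q)ˣ) : ZMod q) - ((p.2.2⁻¹ : (ZMod q)ˣ) : ZMod q) = 0))

lemma sum_stdAddChar_mul (q : ℕ) [NeZero q] (b : ZMod q) :
    ∑ x : ZMod q, (ZMod.stdAddChar (x * b) : ℂ) = if b = 0 then (q : ℂ) else 0 := by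
  rw [AddChar.sum_mulShift b (ZMod.isPrimitive_stdAddChar q), ZMod.card]
  split_ifs <;> simp

lemma kloosterman_fourth_power (q : ℕ) [NeZero q] (m ν : ZMod q) :
    ((‖kloosterman q m ν‖ ^ 4 : ℝ) : ℂ) =
      ∑ p : ((ZMod q)ˣ × (ZMod q)ˣ) × ((ZMod q)ˣ × (ZMod q)ˣ),
        ZMod.stdAddChar (m * ((p.1.1 : ZMod q) + (p.1.2 : ZMod q) - (p.2.1 : ZMod q)
          - (p.2.2 : ZMod q))) *
        ZMod.stdAddChar (ν * (((p.1.1⁻¹ : (ZMod q)ˣ) : ZMod q) + ((p.1.2⁻¹ : (ZMod q)ˣ) : ZMod q)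
        - ((p.2.1⁻¹ : (ZMod q)ˣ) : ZMod q) - ((p.2.2⁻¹ : (ZMod q)ˣ) : ZMod q))) := by
  have h1 : ((‖kloosterman q m ν‖ ^ 4 : ℝ) : ℂ) =
      (kloosterman q m ν * kloosterman q m ν) *
      (starRingEnd ℂ (kloosterman q m ν) * starRingEnd ℂ (kloosterman q m ν)) := by
    have := Complex.mul_conj' (kloosterman q m ν)
    push_cast
    linear_combination (-(‖kloosterman q m ν‖ : ℂ) ^ 2
      - kloosterman q m ν * starRingEnd ℂ (kloosterman q m ν)) * this
  have h2 : starRingEnd ℂ (kloosterman q m ν) = ∑ x : (ZMod q)ˣ,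
      ZMod.stdAddChar (-(m * (x : ZMod q) + ν * ((x⁻¹ : (ZMod q)ˣ) : ZMod q))) := by
    rw [kloosterman, map_sum]
    exact Finset.sum_congr rfl fun x _ => (AddChar.map_neg_eq_conj _ _).symm
  rw [h1, h2, kloosterman, Finset.sum_mul_sum, Finset.sum_mul_sum, ← Fintype.sum_prod_type',
    ← Fintype.sum_prod_type', Finset.sum_mul_sum, ← Fintype.sum_prod_type']
  refine Finset.sum_congr rfl fun p _ => ?_
  simp only [← AddChar.map_add_eq_mul]
  congr 1
  ring

lemma sum_kloosterman_fourth_power (q : ℕ) [NeZero q] :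
    ∑ ν : ZMod q, ∑ m : ZMod q, ‖kloosterman q m ν‖ ^ 4 = (q : ℝ) ^ 2 * (unitQuads q).card := by
  have h : ((∑ ν : ZMod q, ∑ m : ZMod q, ‖kloosterman q m ν‖ ^ 4 : ℝ) : ℂ)
      = (((q : ℝ) ^ 2 * (unitQuads q).card : ℝ) : ℂ) := by
    have e1 : ((∑ ν : ZMod q, ∑ m : ZMod q, ‖kloosterman q m ν‖ ^ 4 : ℝ) : ℂ)
        = ∑ ν : ZMod q, ∑ m : ZMod q, ((‖kloosterman q m ν‖ ^ 4 : ℝ) : ℂ) := by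
      push_cast; rfl
    rw [e1]
    simp only [kloosterman_fourth_power]
    have e2 : ∀ ν : ZMod q, ∀ f g : (((ZMod q)ˣ × (ZMod q)ˣ) × ((ZMod q)ˣ × (ZMod q)ˣ)) → ZMod q,
        ∑ m : ZMod q, ∑ p, (ZMod.stdAddChar (m * f p) : ℂ) * ZMod.stdAddChar (ν * g p)
        = ∑ p, (if f p = 0 then (q : ℂ) else 0) * ZMod.stdAddChar (ν * g p) := by
      intro ν f g
      rw [Finset.sum_comm]
      refine Finset.sum_congr rfl fun p _ => ?_
      rw [← Finset.sum_mul, sum_stdAddChar_mul]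
    simp only [e2]
    rw [Finset.sum_comm]
    simp only [← Finset.mul_sum, sum_stdAddChar_mul]
    rw [unitQuads, Finset.card_filter]
    push_cast
    rw [Finset.mul_sum]
    refine Finset.sum_congr rfl fun p _ => ?_
    split_ifs <;> simp_all [sq]
  exact_mod_cast h

lemma unitQuads_card_le (q : ℕ) [NeZero q] :
    (unitQuads q).card ≤ Fintype.card (ZMod q)ˣ * (2 * q * q.divisors.card ^ 2) := by
  rw [← Finset.card_univ]
  refine le_trans ?_ (Nat.mul_le_mul_left _ (card_pairs_mul_eq_zero q))
  rw [← Finset.card_product]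
  refine Finset.card_le_card_of_injOn
    (fun p => (p.2.2, ((p.1.1 : ZMod q) * ((p.2.2⁻¹ : (ZMod q)ˣ) : ZMod q),
      (p.2.1 : ZMod q) * ((p.2.2⁻¹ : (ZMod q)ˣ) : ZMod q)))) ?_ ?_
  · rintro ⟨⟨a, b⟩, c, d⟩ hp
    simp only [unitQuads, Finset.coe_filter, Finset.mem_univ, true_and, Set.mem_ofPred_eq] at hp
    obtain ⟨h1, h2⟩ := hp
    simp only [Finset.coe_product, Finset.coe_univ, Finset.coe_filter, Finset.mem_univ, true_and,
      Set.mem_prod, Set.mem_univ, Set.mem_ofPred_eq]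
    have ha := a.mul_inv
    have hb := b.mul_inv
    have hc := c.mul_inv
    have hd := d.mul_inv
    generalize ((a⁻¹ : (ZMod q)ˣ) : ZMod q) = a' at *
    generalize ((b⁻¹ : (ZMod q)ˣ) : ZMod q) = b' at *
    generalize ((c⁻¹ : (ZMod q)ˣ) : ZMod q) = c' at *
    generalize ((d⁻¹ : (ZMod q)ˣ) : ZMod q) = d' at *
    generalize (a : ZMod q) = A at *
    generalize (b : ZMod q) = B at *
    generalize (c : ZMod q) = C at *
    generalize (d : ZMod q) = E at *
    have hB : B = C + E - A := by linear_combination h1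
    have hcd : (A + B) * (C * E) = (C + E) * (A * B) := by
      linear_combination (A * B * C * E) * h2 - (B * C * E) * ha - (A * C * E) * hb
        + (A * B * E) * hc + (A * B * C) * hd
    have h3 : (C + E) * ((A - E) * (A - C)) = 0 := by
      subst hB
      linear_combination hcd
    linear_combination d' ^ 3 * h3 +
      (-(A * d' - E * d') * (A * d' - C * d')
        - (C * d' + 1) * (-1) * (A * d' - C * d') ) * hd
  · rintro ⟨⟨a, b⟩, c, d⟩ hp ⟨⟨a', b'⟩, c', d'⟩ hp' h
    simp only [unitQuads, Finset.coe_filter, Finset.mem_univ, true_and, Set.mem_ofPred_eq] at hp hp'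
    simp only [Prod.mk.injEq] at h
    obtain ⟨rfl, h1, h2⟩ := h
    have ha : a = a' := by
      have := (d⁻¹).isUnit.mul_right_cancel h1
      exact Units.ext this
    have hc : c = c' := by
      have := (d⁻¹).isUnit.mul_right_cancel h2
      exact Units.ext this
    subst ha hc
    have hb : b = b' := by
      apply Units.ext
      linear_combination hp.1 - hp'.1
    rw [hb]

/-- Kloosterman's bound for the classical Kloosterman sum, uniformly in `m`. -/
lemma kloosterman_fourth_power_le (q : ℕ) [NeZero q] (m ν : ZMod q) (n : ℕ) (hn : 0 < n)
    (hν : ∀ x : ZMod q, ν * x = 0 → (n : ZMod q) * x = 0) :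
    ‖kloosterman q m ν‖ ^ 4 ≤ 2 * n * (q : ℝ) ^ 3 * (q.divisors.card : ℝ) ^ 2 := by
  have hq : 0 < q := Nat.pos_of_ne_zero (NeZero.ne q)
  have horb : ∀ u : (ZMod q)ˣ, kloosterman q m ν
      = kloosterman q (m * ((u⁻¹ : (ZMod q)ˣ) : ZMod q)) (ν * (u : ZMod q)) := by
    intro u
    unfold kloosterman
    refine Fintype.sum_equiv (Equiv.mulLeft u) _ _ fun x => ?_
    simp only [Equiv.coe_mulLeft, mul_inv, Units.val_mul]
    congr 1
    have := u.mul_inv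
    linear_combination (-(m * (x : ZMod q)) - ν * ((x⁻¹ : (ZMod q)ˣ) : ZMod q)) * this
  set F : ZMod q → ℝ := fun ν' => ∑ m' : ZMod q, ‖kloosterman q m' ν'‖ ^ 4 with hF
  have hF0 : ∀ x, 0 ≤ F x := fun x => Finset.sum_nonneg fun _ _ => by positivity
  have h1 : (Fintype.card (ZMod q)ˣ : ℝ) * ‖kloosterman q m ν‖ ^ 4
      ≤ ∑ u : (ZMod q)ˣ, F (ν * (u : ZMod q)) := by
    rw [← nsmul_eq_mul, ← Finset.card_univ, ← Finset.sum_const]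
    refine Finset.sum_le_sum fun u _ => ?_
    rw [horb u]
    exact Finset.single_le_sum (f := fun m' => ‖kloosterman q m' (ν * (u : ZMod q))‖ ^ 4)
      (fun _ _ => by positivity) (Finset.mem_univ _)
  have hfib : ∀ y : ZMod q,
      ((Finset.univ : Finset (ZMod q)ˣ).filter (fun u : (ZMod q)ˣ => ν * (u : ZMod q) = y)).card
        ≤ n := by
    intro y
    set T := ((Finset.univ : Finset (ZMod q)ˣ).filter
      (fun u : (ZMod q)ˣ => ν * (u : ZMod q) = y)).image
      (fun u : (ZMod q)ˣ => (u : ZMod q).val) with hT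
    have hTc : T.card
        = ((Finset.univ : Finset (ZMod q)ˣ).filter
            (fun u : (ZMod q)ˣ => ν * (u : ZMod q) = y)).card := by
      refine Finset.card_image_of_injOn ?_
      intro u _ v _ huv
      exact Units.ext (ZMod.val_injective q huv)
    rw [← hTc]
    have hD : q / Nat.gcd q n ∣ q := Nat.div_dvd_of_dvd (Nat.gcd_dvd_left q n)
    refine (card_le_div_of_pairwise_dvd hq hD T ?_ ?_).trans ?_
    · intro x hx
      obtain ⟨u, _, rfl⟩ := Finset.mem_image.mp hx
      exact ZMod.val_lt _
    · intro x hx z hz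
      obtain ⟨u, hu, rfl⟩ := Finset.mem_image.mp hx
      obtain ⟨v, hv, rfl⟩ := Finset.mem_image.mp hz
      have hu' := (Finset.mem_filter.mp hu).2
      have hv' := (Finset.mem_filter.mp hv).2
      have h0 : (n : ZMod q) * ((u : ZMod q) - v) = 0 :=
        hν _ (by rw [mul_sub, hu', hv', sub_self])
      have hdv : (q : ℤ) ∣ (n : ℤ) * (((u : ZMod q).val : ℤ) - ((v : ZMod q).val : ℤ)) := by
        rw [← ZMod.intCast_zmod_eq_zero_iff_dvd]
        push_cast
        simpa using h0
      rw [← Int.natAbs_dvd_natAbs, Int.natAbs_mul, Int.natAbs_natCast, Int.natAbs_natCast] at hdv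
      rw [Int.natCast_dvd]
      have hg : 0 < Nat.gcd q n := Nat.gcd_pos_of_pos_left _ hq
      have hco := Nat.coprime_div_gcd_div_gcd hg
      refine hco.dvd_of_dvd_mul_left ?_
      rw [← Nat.mul_dvd_mul_iff_left hg, Nat.mul_div_cancel' (Nat.gcd_dvd_left q n), ← mul_assoc,
        Nat.mul_div_cancel' (Nat.gcd_dvd_right q n)]
      exact hdv
    · rw [Nat.div_div_self (Nat.gcd_dvd_left q n) hq.ne']
      exact Nat.le_of_dvd hn (Nat.gcd_dvd_right q n)
  have h2 : ∑ u : (ZMod q)ˣ, F (ν * (u : ZMod q)) ≤ n * ∑ y : ZMod q, F y := by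
    rw [← Finset.sum_fiberwise (s := Finset.univ) (g := fun u : (ZMod q)ˣ => ν * (u : ZMod q)),
      Finset.mul_sum]
    refine Finset.sum_le_sum fun y _ => ?_
    rw [Finset.sum_congr rfl (g := fun _ => F y)
      (fun u hu => by rw [(Finset.mem_filter.mp hu).2]), Finset.sum_const, nsmul_eq_mul]
    exact mul_le_mul_of_nonneg_right (by exact_mod_cast hfib y) (hF0 y)
  have h3 : ∑ y : ZMod q, F y = (q : ℝ) ^ 2 * (unitQuads q).card :=
    sum_kloosterman_fourth_power q
  have h4 : ((unitQuads q).card : ℝ)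
      ≤ Fintype.card (ZMod q)ˣ * (2 * q * (q.divisors.card : ℝ) ^ 2) := by
    exact_mod_cast unitQuads_card_le q
  have hφ : (0 : ℝ) < Fintype.card (ZMod q)ˣ := by exact_mod_cast Fintype.card_pos
  refine le_of_mul_le_mul_left ?_ hφ
  calc (Fintype.card (ZMod q)ˣ : ℝ) * ‖kloosterman q m ν‖ ^ 4
      ≤ n * ((q : ℝ) ^ 2 * (unitQuads q).card) := by rw [← h3]; exact h1.trans h2
    _ ≤ n * ((q : ℝ) ^ 2 * (Fintype.card (ZMod q)ˣ * (2 * q * (q.divisors.card : ℝ) ^ 2))) := by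
        gcongr
    _ = _ := by ring

lemma four_mul_min_le_norm_stdAddChar_sub_one (q : ℕ) [NeZero q] (m : ZMod q) :
    4 * min (m.val : ℝ) (q - m.val) / q ≤ ‖(ZMod.stdAddChar m : ℂ) - 1‖ := by
  have hq : (0 : ℝ) < q := by exact_mod_cast Nat.pos_of_ne_zero (NeZero.ne q)
  have hv : (m.val : ℝ) < q := by exact_mod_cast ZMod.val_lt m
  have hv0 : (0 : ℝ) ≤ m.val := Nat.cast_nonneg _
  have h1 : (ZMod.stdAddChar m : ℂ) = Complex.exp (Complex.I * ((2 * π * m.val / q : ℝ) : ℂ)) := by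
    have := ZMod.stdAddChar_coe (N := q) (m.val : ℤ)
    simp only [Int.cast_natCast, ZMod.natCast_zmod_val] at this
    rw [this]
    congr 1
    push_cast
    ring
  rw [h1, Complex.norm_exp_I_mul_ofReal_sub_one, Real.norm_eq_abs]
  have h2 : 2 * π * (m.val : ℝ) / q / 2 = π * (m.val / q) := by ring
  rw [h2]
  refine le_trans ?_ (le_abs_self _)
  have hpi := Real.pi_pos
  rcases le_total ((m.val : ℝ) / q) (1 / 2) with h | h
  · have := Real.mul_le_sin (x := π * (m.val / q)) (by positivity) (by nlinarith)
    have e : 2 / π * (π * ((m.val : ℝ) / q)) = 2 * (m.val / q) := by field_simp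
    rw [e] at this
    calc 4 * min (m.val : ℝ) (q - m.val) / q ≤ 4 * m.val / q := by
          gcongr; exact min_le_left _ _
      _ = 2 * (2 * (m.val / q)) := by ring
      _ ≤ _ := by linarith
  · have hle : (m.val : ℝ) / q ≤ 1 := (div_le_one hq).mpr hv.le
    have := Real.mul_le_sin (x := π - π * (m.val / q)) (by nlinarith) (by nlinarith)
    rw [Real.sin_pi_sub] at this
    have e : 2 / π * (π - π * ((m.val : ℝ) / q)) = 2 * (1 - m.val / q) := by field_simp
    rw [e] at this
    calc 4 * min (m.val : ℝ) (q - m.val) / q ≤ 4 * (q - m.val) / q := by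
          gcongr; exact min_le_right _ _
      _ = 2 * (2 * (1 - m.val / q)) := by field_simp; ring
      _ ≤ _ := by linarith

lemma sum_inv_val_add_inv_sub_val_le (q : ℕ) [NeZero q] :
    ∑ m ∈ (Finset.univ : Finset (ZMod q)).erase 0, (1 / (m.val : ℝ) + 1 / (q - m.val))
      ≤ 2 * (1 + Real.log q) := by
  have hq : 0 < q := Nat.pos_of_ne_zero (NeZero.ne q)
  have h1 : ∑ m ∈ (Finset.univ : Finset (ZMod q)).erase 0, (1 / (m.val : ℝ) + 1 / (q - m.val))
      = ∑ v ∈ Finset.Ico 1 q, (1 / (v : ℝ) + 1 / ((q - v : ℕ) : ℝ)) := by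
    refine Finset.sum_nbij ZMod.val ?_ ?_ ?_ ?_
    · intro m hm
      rw [Finset.mem_Ico]
      refine ⟨Nat.pos_of_ne_zero fun h => (Finset.mem_erase.mp hm).1 ?_, ZMod.val_lt m⟩
      exact (ZMod.val_eq_zero m).mp h
    · exact (ZMod.val_injective q).injOn
    · intro v hv
      simp only [Finset.coe_Ico, Set.mem_Ico] at hv
      refine ⟨(v : ZMod q), ?_, ZMod.val_cast_of_lt hv.2⟩
      simp only [Finset.coe_erase, Finset.coe_univ, Set.mem_sdiff, Set.mem_univ, true_and,
        Set.mem_singleton_iff]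
      intro h
      have := ZMod.val_cast_of_lt hv.2
      rw [h, ZMod.val_zero] at this
      omega
    · intro m _
      rw [Nat.cast_sub (ZMod.val_lt m).le]
  have h2 : ∑ v ∈ Finset.Ico 1 q, 1 / ((q - v : ℕ) : ℝ) = ∑ v ∈ Finset.Ico 1 q, 1 / (v : ℝ) := by
    refine Finset.sum_nbij' (fun v => q - v) (fun v => q - v) ?_ ?_ ?_ ?_ ?_
    · intro v hv; simp only [Finset.mem_Ico] at *; omega
    · intro v hv; simp only [Finset.mem_Ico] at *; omega
    · intro v hv; simp only [Finset.mem_Ico] at *; omega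
    · intro v hv; simp only [Finset.mem_Ico] at *; omega
    · intro v hv; rfl
  have h3 : ∑ v ∈ Finset.Ico 1 q, 1 / (v : ℝ) ≤ 1 + Real.log q := by
    refine le_trans ?_ (harmonic_le_one_add_log q)
    rw [harmonic_eq_sum_Icc]
    push_cast
    simp only [one_div]
    refine Finset.sum_le_sum_of_subset_of_nonneg ?_ fun _ _ _ => by positivity
    intro v hv
    simp only [Finset.mem_Ico, Finset.mem_Icc] at *
    omega
  rw [h1, Finset.sum_add_distrib, h2]
  linarith

/-- Completion: twisting a complete exponential sum by a function of bounded variation costs at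
most a logarithm. -/
lemma norm_twisted_sum_le (q : ℕ) [NeZero q] (ν : ZMod q) (f : ZMod q → ℂ) (V B : ℝ)
    (hf : ∀ x, ‖f x‖ ≤ 1) (hV : ∑ x, ‖f (x + 1) - f x‖ ≤ V)
    (hB : ∀ m, ‖kloosterman q m ν‖ ≤ B) :
    ‖∑ u : (ZMod q)ˣ, f u * ZMod.stdAddChar (ν * ((u⁻¹ : (ZMod q)ˣ) : ZMod q))‖
      ≤ (1 + V / 2 * (1 + Real.log q)) * B := by
  have hq : (0 : ℝ) < q := by exact_mod_cast Nat.pos_of_ne_zero (NeZero.ne q)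
  have hV0 : 0 ≤ V := le_trans (Finset.sum_nonneg fun _ _ => norm_nonneg _) hV
  have hB0 : 0 ≤ B := (norm_nonneg _).trans (hB 0)
  set F : ZMod q → ℂ := fun m => ∑ y, f y * ZMod.stdAddChar (-(m * y)) with hF
  have hinv : ∀ x, (q : ℂ) * f x = ∑ m, F m * ZMod.stdAddChar (m * x) := by
    intro x
    simp only [hF, Finset.sum_mul]
    rw [Finset.sum_comm]
    have : ∀ y, ∑ m : ZMod q, f y * ZMod.stdAddChar (-(m * y)) * ZMod.stdAddChar (m * x)
        = if y = x then (q : ℂ) * f y else 0 := by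
      intro y
      have e : ∀ m : ZMod q, f y * ZMod.stdAddChar (-(m * y)) * ZMod.stdAddChar (m * x)
          = f y * ZMod.stdAddChar (m * (x - y)) := by
        intro m
        rw [mul_assoc, ← AddChar.map_add_eq_mul]
        congr 2
        ring
      simp only [e, ← Finset.mul_sum, sum_stdAddChar_mul]
      by_cases hxy : y = x
      · simp [hxy, mul_comm]
      · simp [hxy, sub_ne_zero.mpr (Ne.symm hxy)]
    simp only [this]
    simp
  have hK : (q : ℂ) * ∑ u : (ZMod q)ˣ, f u * ZMod.stdAddChar (ν * ((u⁻¹ : (ZMod q)ˣ) : ZMod q))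
      = ∑ m, F m * kloosterman q m ν := by
    simp only [Finset.mul_sum, ← mul_assoc, hinv, kloosterman, Finset.sum_mul]
    rw [Finset.sum_comm]
    refine Finset.sum_congr rfl fun m _ => Finset.sum_congr rfl fun u _ => ?_
    rw [mul_assoc, ← AddChar.map_add_eq_mul]
  have hF0 : ‖F 0‖ ≤ q := by
    refine (norm_sum_le _ _).trans ?_
    calc ∑ y : ZMod q, ‖f y * ZMod.stdAddChar (-(0 * y))‖ ≤ ∑ _y : ZMod q, (1 : ℝ) := by
          refine Finset.sum_le_sum fun y _ => ?_
          rw [norm_mul, AddChar.norm_apply, mul_one]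
          exact hf y
      _ = q := by simp [ZMod.card]
  have hFm : ∀ m : ZMod q, ‖F m‖ * ‖(ZMod.stdAddChar m : ℂ) - 1‖ ≤ V := by
    intro m
    have e : F m * ((ZMod.stdAddChar m : ℂ) - 1)
        = ∑ y, (f (y + 1) - f y) * ZMod.stdAddChar (-(m * y)) := by
      simp only [hF, sub_mul, Finset.sum_sub_distrib, mul_sub, mul_one]
      congr 1
      rw [Finset.sum_mul]
      refine (Fintype.sum_equiv (Equiv.addRight (1 : ZMod q)) _ _ fun y => ?_).symm
      simp only [Equiv.coe_addRight]
      rw [mul_assoc, ← AddChar.map_add_eq_mul]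
      congr 2
      ring
    rw [← norm_mul, e]
    refine (norm_sum_le _ _).trans (le_trans (Finset.sum_le_sum fun y _ => ?_) hV)
    rw [norm_mul, AddChar.norm_apply, mul_one]
  have hFm' : ∀ m ∈ (Finset.univ : Finset (ZMod q)).erase 0,
      ‖F m‖ ≤ V * q / 4 * (1 / (m.val : ℝ) + 1 / (q - m.val)) := by
    intro m hm
    have hm0 : m ≠ 0 := (Finset.mem_erase.mp hm).1
    have hv : (0 : ℝ) < m.val := by
      exact_mod_cast Nat.pos_of_ne_zero (by rwa [Ne, ZMod.val_eq_zero])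
    have hv' : (0 : ℝ) < q - m.val := by
      rw [sub_pos]; exact_mod_cast ZMod.val_lt m
    have hmin : 0 < min (m.val : ℝ) (q - m.val) := lt_min hv hv'
    have h1 := four_mul_min_le_norm_stdAddChar_sub_one q m
    have h2 : ‖F m‖ * (4 * min (m.val : ℝ) (q - m.val) / q) ≤ V :=
      (mul_le_mul_of_nonneg_left h1 (norm_nonneg _)).trans (hFm m)
    have h3 : ‖F m‖ ≤ V * q / 4 * (1 / min (m.val : ℝ) (q - m.val)) := by
      rw [← le_div_iff₀ (by positivity)] at h2
      refine h2.trans (le_of_eq ?_)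
      field_simp
    refine h3.trans ?_
    have hc : 0 ≤ V * q / 4 := by positivity
    refine mul_le_mul_of_nonneg_left ?_ hc
    have p1 : 0 < 1 / (m.val : ℝ) := by positivity
    have p2 : 0 < 1 / ((q : ℝ) - m.val) := by positivity
    rcases min_choice (m.val : ℝ) (q - m.val) with h | h <;> rw [h] <;> linarith
  have hsum : ∑ m, ‖F m‖ ≤ q * (1 + V / 2 * (1 + Real.log q)) := by
    rw [← Finset.add_sum_erase _ _ (Finset.mem_univ (0 : ZMod q))]
    have := Finset.sum_le_sum hFm'
    rw [← Finset.mul_sum] at this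
    have h2 := mul_le_mul_of_nonneg_left (sum_inv_val_add_inv_sub_val_le q)
      (show 0 ≤ V * q / 4 by positivity)
    nlinarith
  have hfin : q * ‖∑ u : (ZMod q)ˣ, f u * ZMod.stdAddChar (ν * ((u⁻¹ : (ZMod q)ˣ) : ZMod q))‖
      ≤ q * ((1 + V / 2 * (1 + Real.log q)) * B) := by
    have e : q * ‖∑ u : (ZMod q)ˣ, f u * ZMod.stdAddChar (ν * ((u⁻¹ : (ZMod q)ˣ) : ZMod q))‖
        = ‖∑ m, F m * kloosterman q m ν‖ := by
      rw [← hK, norm_mul, Complex.norm_natCast]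
    rw [e]
    calc ‖∑ m, F m * kloosterman q m ν‖ ≤ ∑ m, ‖F m‖ * B := by
          refine (norm_sum_le _ _).trans (Finset.sum_le_sum fun m _ => ?_)
          rw [norm_mul]
          exact mul_le_mul_of_nonneg_left (hB m) (norm_nonneg _)
      _ = (∑ m, ‖F m‖) * B := by rw [Finset.sum_mul]
      _ ≤ _ := by rw [← mul_assoc]; exact mul_le_mul_of_nonneg_right hsum hB0
  exact le_of_mul_le_mul_left hfin hq

/-- The Kloosterman sum modulo `q` with a real first argument `t`. -/
def realKloosterman (q : ℕ) [NeZero q] (ν : ZMod q) (t : ℝ) : ℂ :=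
  ∑ u : (ZMod q)ˣ, ee ((t * (u : ZMod q).valMinAbs / q : ℝ) : ℂ) *
    ZMod.stdAddChar (ν * ((u⁻¹ : (ZMod q)ˣ) : ZMod q))

lemma ee_ofReal (x : ℝ) : ee (x : ℂ) = Complex.exp (Complex.I * ((2 * π * x : ℝ) : ℂ)) := by
  unfold ee
  congr 1
  push_cast
  ring

lemma norm_ee_ofReal (x : ℝ) : ‖ee (x : ℂ)‖ = 1 := by
  rw [ee_ofReal, mul_comm]
  exact Complex.norm_exp_ofReal_mul_I _

lemma ee_add (x y : ℂ) : ee (x + y) = ee x * ee y := by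
  unfold ee
  rw [← Complex.exp_add]
  congr 1
  ring

lemma norm_ee_ofReal_sub_one_le (x : ℝ) : ‖ee (x : ℂ) - 1‖ ≤ 2 * π * |x| := by
  rw [ee_ofReal]
  refine (Real.norm_exp_I_mul_ofReal_sub_one_le).trans (le_of_eq ?_)
  rw [Real.norm_eq_abs, abs_mul, abs_of_pos (by positivity : 0 < 2 * π)]

lemma variation_ee_valMinAbs_le (q : ℕ) [NeZero q] (t : ℝ) (ht0 : 0 ≤ t) (ht1 : t ≤ 1) :
    ∑ x : ZMod q, ‖ee ((t * (x + 1).valMinAbs / q : ℝ) : ℂ) - ee ((t * x.valMinAbs / q : ℝ) : ℂ)‖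
      ≤ 9 := by
  have hq : (0 : ℝ) < q := by exact_mod_cast Nat.pos_of_ne_zero (NeZero.ne q)
  have hpi := Real.pi_lt_d2
  calc _ ≤ ∑ x : ZMod q, (2 * π / q + if x = ((q / 2 : ℕ) : ZMod q) then 2 else 0) := by
        refine Finset.sum_le_sum fun x _ => ?_
        have hx := ZMod.valMinAbs_mem_Ioc x
        by_cases h : (x.valMinAbs + 1) * 2 ≤ q
        · have e : (x + 1).valMinAbs = x.valMinAbs + 1 := by
            rw [ZMod.valMinAbs_spec]
            refine ⟨by push_cast; simp, ?_, h⟩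
            have := hx.1
            omega
          rw [e]
          have e2 : ((t * ((x.valMinAbs + 1 : ℤ) : ℝ) / q : ℝ) : ℂ)
              = ((t * x.valMinAbs / q : ℝ) : ℂ) + ((t / q : ℝ) : ℂ) := by
            push_cast; ring
          rw [e2, ee_add]
          have e3 : ∀ a b : ℂ, a * b - a = a * (b - 1) := fun a b => by ring
          rw [e3, norm_mul, norm_ee_ofReal, one_mul]
          have h1 := norm_ee_ofReal_sub_one_le (t / q)
          have h2 : 2 * π * |t / q| ≤ 2 * π / q := by
            rw [abs_of_nonneg (by positivity), ← mul_div_assoc]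
            have : 2 * π * t ≤ 2 * π := by nlinarith [Real.pi_pos]
            gcongr
          have h3 : (0 : ℝ) ≤ if x = ((q / 2 : ℕ) : ZMod q) then 2 else 0 := by
            split_ifs <;> norm_num
          linarith
        · have e : x = ((q / 2 : ℕ) : ZMod q) := by
            have h2 : x.valMinAbs = ((q / 2 : ℕ) : ℤ) := by
              have := hx.2
              omega
            rw [← ZMod.coe_valMinAbs x, h2, Int.cast_natCast]
          rw [if_pos e]
          have h1 := norm_sub_le (ee ((t * (x + 1).valMinAbs / q : ℝ) : ℂ))
            (ee ((t * x.valMinAbs / q : ℝ) : ℂ))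
          rw [norm_ee_ofReal, norm_ee_ofReal] at h1
          have : 0 ≤ 2 * π / q := by positivity
          linarith
    _ = 2 * π + 2 := by
        rw [Finset.sum_add_distrib, Finset.sum_ite_eq' Finset.univ]
        simp only [Finset.sum_const, Finset.card_univ, ZMod.card, nsmul_eq_mul, Finset.mem_univ,
          if_true]
        field_simp
    _ ≤ 9 := by linarith

/-- Power-saving bound for Kloosterman sums with a real first argument. -/
lemma norm_realKloosterman_le (q : ℕ) [NeZero q] (ν : ZMod q) (n : ℕ) (hn : 0 < n)
    (hν : ∀ x : ZMod q, ν * x = 0 → (n : ZMod q) * x = 0) (t : ℝ) (ht0 : 0 ≤ t) (ht1 : t ≤ 1) :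
    ‖realKloosterman q ν t‖ ≤ 84 * n * ((q.divisors.card : ℝ) * (q : ℝ) ^ (7 / 8 : ℝ)) := by
  have hq0 : 0 < q := Nat.pos_of_ne_zero (NeZero.ne q)
  have hq : (1 : ℝ) ≤ q := by exact_mod_cast hq0
  have hn1 : (1 : ℝ) ≤ n := by exact_mod_cast hn
  have hτ : (1 : ℝ) ≤ q.divisors.card := by
    exact_mod_cast Finset.card_pos.mpr ⟨1, Nat.one_mem_divisors.mpr hq0.ne'⟩
  set τ : ℝ := ((q.divisors.card : ℕ) : ℝ) with hτdef
  have hB : ∀ m, ‖kloosterman q m ν‖ ≤ 2 * n * (q : ℝ) ^ (3 / 4 : ℝ) * τ := by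
    intro m
    have h1 := kloosterman_fourth_power_le q m ν n hn hν
    refine le_of_pow_le_pow_left₀ (n := 4) (by norm_num) (by positivity) (h1.trans ?_)
    have e : ((q : ℝ) ^ (3 / 4 : ℝ)) ^ 4 = (q : ℝ) ^ 3 := by
      rw [← Real.rpow_natCast, ← Real.rpow_mul (by positivity), ← Real.rpow_natCast]
      norm_num
    have e2 : (2 * n * (q : ℝ) ^ (3 / 4 : ℝ) * τ) ^ 4 = (2 * n) ^ 4 * (q : ℝ) ^ 3 * τ ^ 4 := by
      rw [mul_pow, mul_pow, e]
    rw [e2]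
    have h2 : (2 * n : ℝ) ≤ (2 * n : ℝ) ^ 4 := le_self_pow₀ (by linarith) (by norm_num)
    have h3 : τ ^ 2 ≤ τ ^ 4 := pow_le_pow_right₀ hτ (by norm_num)
    gcongr
  have h := norm_twisted_sum_le q ν (fun x => ee ((t * x.valMinAbs / q : ℝ) : ℂ)) 9 _
    (fun x => (norm_ee_ofReal _).le) (variation_ee_valMinAbs_le q t ht0 ht1) hB
  refine h.trans ?_
  have hlog : Real.log q ≤ 8 * (q : ℝ) ^ (1 / 8 : ℝ) := by
    have := Real.log_le_rpow_div (x := (q : ℝ)) (by positivity) (show (0 : ℝ) < 1 / 8 by norm_num)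
    linarith
  have hq8 : 1 ≤ (q : ℝ) ^ (1 / 8 : ℝ) := Real.one_le_rpow hq (by norm_num)
  have hl : 1 + 9 / 2 * (1 + Real.log q) ≤ 42 * (q : ℝ) ^ (1 / 8 : ℝ) := by linarith
  have e : (q : ℝ) ^ (7 / 8 : ℝ) = (q : ℝ) ^ (1 / 8 : ℝ) * (q : ℝ) ^ (3 / 4 : ℝ) := by
    rw [← Real.rpow_add (by positivity)]
    norm_num
  rw [e]
  calc _ ≤ 42 * (q : ℝ) ^ (1 / 8 : ℝ) * (2 * n * (q : ℝ) ^ (3 / 4 : ℝ) * τ) := by gcongr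
    _ = _ := by ring

lemma summable_card_divisors_mul_rpow :
    Summable (fun q : ℕ => (q.divisors.card : ℝ) * (q : ℝ) ^ (7 / 8 : ℝ) / (q : ℝ) ^ 2) := by
  have hz : LSeriesSummable
      (fun n => ((ArithmeticFunction.zeta : ArithmeticFunction ℕ) : ArithmeticFunction ℂ) n)
      ((9 / 8 : ℝ) : ℂ) := by
    have := (ArithmeticFunction.LSeriesSummable_zeta_iff (s := ((9 / 8 : ℝ) : ℂ))).mpr
      (by rw [Complex.ofReal_re]; norm_num)
    simpa using this
  have hm := (ArithmeticFunction.LSeriesSummable_mul hz hz).norm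
  refine hm.congr fun q => ?_
  rcases Nat.eq_zero_or_pos q with rfl | hq
  · simp
  have e : (((ArithmeticFunction.zeta : ArithmeticFunction ℕ) : ArithmeticFunction ℂ) *
      ((ArithmeticFunction.zeta : ArithmeticFunction ℕ) : ArithmeticFunction ℂ)) q
      = (q.divisors.card : ℂ) := by
    rw [ArithmeticFunction.coe_zeta_mul_apply]
    rw [Finset.card_eq_sum_ones]
    push_cast
    refine Finset.sum_congr rfl fun d hd => ?_
    rw [ArithmeticFunction.natCoe_apply, ArithmeticFunction.zeta_apply_ne
      (Nat.pos_of_mem_divisors hd).ne']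
    simp
  have hq' : (0 : ℝ) < q := by exact_mod_cast hq
  rw [LSeries.norm_term_eq, if_neg hq.ne', e, Complex.norm_natCast, Complex.ofReal_re,
    mul_div_assoc]
  have e3 : (q : ℝ) ^ (7 / 8 : ℝ) = (q : ℝ) ^ 2 / (q : ℝ) ^ (9 / 8 : ℝ) := by
    rw [← Real.rpow_natCast, ← Real.rpow_sub hq']
    norm_num
  rw [e3]
  field_simp

lemma epsFactor_pow_four (d : ℕ) : epsFactor d ^ 4 = 1 := by
  unfold epsFactor
  split_ifs
  · simp
  · exact Complex.I_pow_four

lemma jacobiSym_pow_four {a : ℤ} {b : ℕ} (h : IsCoprime a (b : ℤ)) :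
    ((jacobiSym a b : ℤ) : ℂ) ^ 4 = 1 := by
  have := jacobiSym.sq_one (Int.isCoprime_iff_gcd_eq_one.mp h)
  have h4 : (jacobiSym a b) ^ 4 = 1 := by
    rw [show 4 = 2 * 2 from rfl, pow_mul, this, one_pow]
  exact_mod_cast h4

lemma stdAddChar_intCast (q : ℕ) [NeZero q] (j : ℤ) :
    (ZMod.stdAddChar (j : ZMod q) : ℂ) = ee ((j / q : ℝ) : ℂ) := by
  rw [ZMod.stdAddChar_coe]
  unfold ee
  congr 1
  push_cast
  ring

lemma RKe_four_eq (t : ℝ) (n c : ℕ) (hc : Even c) (hc0 : 0 < c) [NeZero (2 * c)] :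
    RKe t n c 4 = realKloosterman (2 * c) (n : ZMod (2 * c)) t := by
  have : Fact (1 < 2 * c) := ⟨by omega⟩
  unfold RKe realKloosterman
  rw [← Finset.sum_product', ← Finset.sum_filter]
  symm
  refine Finset.sum_nbij (fun u : (ZMod (2 * c))ˣ =>
    ((u : ZMod (2 * c)).valMinAbs, ((u⁻¹ : (ZMod (2 * c))ˣ) : ZMod (2 * c)).val)) ?_ ?_ ?_ ?_
  · intro u _
    have hu := u.mul_inv
    have h1 := ZMod.valMinAbs_mem_Ioc (u : ZMod (2 * c))
    obtain ⟨h1, h2⟩ := h1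
    push_cast at h1 h2
    have hne : (u : ZMod (2 * c)).valMinAbs ≠ c := by
      intro h
      have e : (u : ZMod (2 * c)) = (c : ZMod (2 * c)) := by
        rw [← ZMod.coe_valMinAbs (u : ZMod (2 * c)), h, Int.cast_natCast]
      have e0 : (2 : ZMod (2 * c)) * (u : ZMod (2 * c)) = 0 := by
        rw [e]
        exact_mod_cast ZMod.natCast_self (2 * c)
      have e2 : ((2 : ℕ) : ZMod (2 * c)) = 0 := by
        push_cast
        linear_combination ((u⁻¹ : (ZMod (2 * c))ˣ) : ZMod (2 * c)) * e0 - 2 * hu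
      rw [ZMod.natCast_eq_zero_iff] at e2
      have := Nat.le_of_dvd (by norm_num) e2
      obtain ⟨k, rfl⟩ := hc
      omega
    have hv : ((u⁻¹ : (ZMod (2 * c))ˣ) : ZMod (2 * c)).val ≠ 0 := by
      rw [Ne, ZMod.val_eq_zero]
      exact Units.ne_zero _
    simp only [Finset.mem_filter, Finset.mem_product, Finset.mem_Ico]
    refine ⟨⟨⟨by omega, by omega⟩, by omega, ZMod.val_lt _⟩, ?_⟩
    have hmod : ((u : ZMod (2 * c)).valMinAbs
        * (((u⁻¹ : (ZMod (2 * c))ˣ) : ZMod (2 * c)).val : ℤ)) ≡ 1 [ZMOD ((2 * c : ℕ) : ℤ)] := by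
      rw [← ZMod.intCast_eq_intCast_iff]
      push_cast
      simp
    have h3 := hmod.eq
    rw [Int.emod_eq_of_lt (a := 1) (by norm_num) (by push_cast; omega)] at h3
    exact_mod_cast h3
  · intro u _ v _ h
    simp only [Prod.mk.injEq] at h
    apply Units.ext
    rw [← ZMod.coe_valMinAbs (u : ZMod (2 * c)), h.1, ZMod.coe_valMinAbs]
  · rintro ⟨a, d⟩ h
    simp only [Finset.coe_filter, Finset.mem_product, Finset.mem_Ico, Set.mem_ofPred_eq] at h
    obtain ⟨⟨⟨h1, h2⟩, h3, h4⟩, h5⟩ := h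
    have hmod : (a : ZMod (2 * c)) * (d : ZMod (2 * c)) = 1 := by
      have : a * (d : ℤ) ≡ 1 [ZMOD ((2 * c : ℕ) : ℤ)] := by
        rw [Int.ModEq, Int.emod_eq_of_lt (a := 1) (by norm_num) (by push_cast; omega)]
        exact_mod_cast h5
      rw [← ZMod.intCast_eq_intCast_iff] at this
      push_cast at this
      exact this
    refine ⟨⟨(a : ZMod (2 * c)), (d : ZMod (2 * c)), hmod, (mul_comm _ _).trans hmod⟩,
      Finset.mem_coe.mpr (Finset.mem_univ _), ?_⟩
    refine Prod.ext ?_ ?_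
    · simp only
      rw [ZMod.valMinAbs_spec]
      refine ⟨rfl, ?_, ?_⟩ <;> push_cast <;> omega
    · exact ZMod.val_cast_of_lt h4
  · intro u _
    have hu := u.mul_inv
    simp only
    set a := (u : ZMod (2 * c)).valMinAbs with ha
    set d := ((u⁻¹ : (ZMod (2 * c))ˣ) : ZMod (2 * c)).val with hd
    have hdc : ((u⁻¹ : (ZMod (2 * c))ˣ) : ZMod (2 * c)) = (d : ZMod (2 * c)) := by
      rw [hd, ZMod.natCast_zmod_val]
    have hco : IsCoprime (2 * (c : ℤ)) (d : ℤ) := by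
      have h1 : IsUnit ((d : ℕ) : ZMod (2 * c)) := hdc ▸ (u⁻¹).isUnit
      rw [ZMod.isUnit_iff_coprime] at h1
      have := (Nat.isCoprime_iff_coprime.mpr h1).symm
      push_cast at this
      exact this
    rw [epsFactor_pow_four, jacobiSym_pow_four hco, one_mul, one_mul]
    have e : ((n : ZMod (2 * c)) * ((u⁻¹ : (ZMod (2 * c))ˣ) : ZMod (2 * c)))
        = (((n : ℤ) * (d : ℤ) : ℤ) : ZMod (2 * c)) := by
      rw [hdc]; push_cast; rfl
    rw [e, stdAddChar_intCast, ← ee_add]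
    congr 1
    push_cast
    ring

/-- The unit `4` modulo an odd number. -/
def unitFour (c : ℕ) (hc : Odd c) : (ZMod c)ˣ :=
  ZMod.unitOfCoprime 4 (by
    rw [show 4 = 2 ^ 2 from rfl]
    exact Nat.Coprime.pow_left 2 (Nat.coprime_two_left.mpr hc))

lemma coe_unitFour (c : ℕ) (hc : Odd c) : (unitFour c hc : ZMod c) = 4 := by
  rw [unitFour, ZMod.coe_unitOfCoprime]
  rfl

lemma ee_half : ee (((4 : ℕ) : ℂ) / 8) = -1 := by
  unfold ee
  rw [← Complex.exp_pi_mul_I]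
  congr 1
  push_cast
  ring

lemma RKo_four_eq (t : ℝ) (n c : ℕ) (hc : Odd c) [NeZero c] :
    RKo t n c 4 = -realKloosterman c
      ((n : ZMod c) * (((unitFour c hc)⁻¹ : (ZMod c)ˣ) : ZMod c)) t := by
  have hc0 : 0 < c := hc.pos
  unfold RKo realKloosterman
  rw [ee_half, inv_pow, epsFactor_pow_four, inv_one, mul_one, neg_one_mul]
  congr 1
  rw [← Finset.sum_product', ← Finset.sum_filter]
  symm
  set f := unitFour c hc with hf
  have hf4 : (f : ZMod c) = 4 := coe_unitFour c hc
  have hff := f.mul_inv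
  refine Finset.sum_nbij (fun u : (ZMod c)ˣ =>
    (2 * (u : ZMod c).valMinAbs, 2 * (-((((f⁻¹ : (ZMod c)ˣ) : ZMod c)) *
      ((u⁻¹ : (ZMod c)ˣ) : ZMod c))).val)) ?_ ?_ ?_ ?_
  · intro u _
    have hu := u.mul_inv
    obtain ⟨h1, h2⟩ := ZMod.valMinAbs_mem_Ioc (u : ZMod c)
    have hv := ZMod.val_lt (-((((f⁻¹ : (ZMod c)ˣ) : ZMod c)) * ((u⁻¹ : (ZMod c)ˣ) : ZMod c)))
    obtain ⟨k, hk⟩ := hc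
    simp only [Finset.mem_filter, Finset.mem_product, Finset.mem_Ico, Finset.mem_range]
    refine ⟨⟨⟨by omega, by omega⟩, by omega⟩, by omega, by omega, ?_⟩
    have hmod : (2 * (u : ZMod c).valMinAbs) * ((2 * (-((((f⁻¹ : (ZMod c)ˣ) : ZMod c)) *
      ((u⁻¹ : (ZMod c)ˣ) : ZMod c))).val : ℕ) : ℤ) ≡ -1 [ZMOD (c : ℤ)] := by
      rw [← ZMod.intCast_eq_intCast_iff]
      push_cast
      rw [ZMod.natCast_zmod_val]
      rw [hf4] at hff
      linear_combination (-4 * ((f⁻¹ : (ZMod c)ˣ) : ZMod c)) * hu - hff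
    exact hmod.eq
  · intro u _ v _ h
    simp only [Prod.mk.injEq] at h
    apply Units.ext
    have h1 : (u : ZMod c).valMinAbs = (v : ZMod c).valMinAbs := by omega
    rw [← ZMod.coe_valMinAbs (u : ZMod c), h1, ZMod.coe_valMinAbs]
  · rintro ⟨b, d⟩ h
    simp only [Finset.coe_filter, Finset.mem_product, Finset.mem_Ico, Finset.mem_range,
      Set.mem_ofPred_eq] at h
    obtain ⟨⟨⟨h1, h2⟩, h3⟩, h4, h5, h6⟩ := h
    obtain ⟨a, rfl⟩ := Int.dvd_of_emod_eq_zero h4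
    obtain ⟨e, rfl⟩ := Nat.dvd_of_mod_eq_zero h5
    have hmod : (4 : ZMod c) * (a : ZMod c) * (e : ZMod c) = -1 := by
      have : 2 * a * ((2 * e : ℕ) : ℤ) ≡ -1 [ZMOD (c : ℤ)] := h6
      rw [← ZMod.intCast_eq_intCast_iff] at this
      push_cast at this
      linear_combination this
    have hinv : (a : ZMod c) * (-(4 * (e : ZMod c))) = 1 := by linear_combination -hmod
    refine ⟨⟨(a : ZMod c), -(4 * (e : ZMod c)), hinv, (mul_comm _ _).trans hinv⟩,
      Finset.mem_coe.mpr (Finset.mem_univ _), ?_⟩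
    refine Prod.ext ?_ ?_
    · simp only
      congr 1
      rw [ZMod.valMinAbs_spec]
      refine ⟨rfl, ?_, ?_⟩ <;> omega
    · simp only [Units.inv_mk]
      congr 1
      have e1 : -(((f⁻¹ : (ZMod c)ˣ) : ZMod c) * -(4 * (e : ZMod c))) = (e : ZMod c) := by
        rw [hf4] at hff
        linear_combination (e : ZMod c) * hff
      rw [e1]
      exact ZMod.val_cast_of_lt (by omega)
  · intro u _
    have hu := u.mul_inv
    simp only
    set a := (u : ZMod c).valMinAbs with ha
    set d := (-((((f⁻¹ : (ZMod c)ˣ) : ZMod c)) * ((u⁻¹ : (ZMod c)ˣ) : ZMod c))).val with hd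
    have hdc : (d : ZMod c)
        = -((((f⁻¹ : (ZMod c)ˣ) : ZMod c)) * ((u⁻¹ : (ZMod c)ˣ) : ZMod c)) := by
      rw [hd, ZMod.natCast_zmod_val]
    have hco : IsCoprime (-(2 * ((2 * d : ℕ) : ℤ))) (c : ℤ) := by
      have h1 : IsUnit ((4 * d : ℕ) : ZMod c) := by
        push_cast
        rw [hdc, ← hf4]
        exact f.isUnit.mul (IsUnit.neg ((f⁻¹).isUnit.mul (u⁻¹).isUnit))
      rw [ZMod.isUnit_iff_coprime] at h1
      have := (Nat.isCoprime_iff_coprime.mpr h1)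
      refine IsCoprime.neg_left ?_
      push_cast at this ⊢
      rw [← mul_assoc]
      exact this
    rw [jacobiSym_pow_four hco, one_mul]
    have e : (n : ZMod c) * ((f⁻¹ : (ZMod c)ˣ) : ZMod c) * ((u⁻¹ : (ZMod c)ˣ) : ZMod c)
        = ((-((n : ℤ) * (d : ℤ)) : ℤ) : ZMod c) := by
      push_cast
      rw [hdc]
      ring
    rw [e, stdAddChar_intCast, ← ee_add]
    have hcc : (c : ℂ) ≠ 0 := by exact_mod_cast hc0.ne'
    congr 1
    push_cast
    field_simp
    ring

lemma continuous_realKloosterman (q : ℕ) [NeZero q] (ν : ZMod q) :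
    Continuous (realKloosterman q ν) := by
  unfold realKloosterman ee
  fun_prop

/-- The even entire function with `J₁(x) = (x / 2) * besselFactor x`. -/
def besselFactor (x : ℝ) : ℝ :=
  ∑' j : ℕ, (-1) ^ j * (x / 2) ^ (2 * j) / ((j.factorial : ℝ) * (j + 1).factorial)

lemma J1_eq (x : ℝ) : J1 x = x / 2 * besselFactor x := by
  unfold J1 besselFactor
  rw [← tsum_mul_left]
  refine tsum_congr fun j => ?_
  rw [pow_succ]
  ring

lemma norm_besselFactor_term_le {x : ℝ} (hx : |x| ≤ 2) (j : ℕ) :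
    ‖(-1) ^ j * (x / 2) ^ (2 * j) / ((j.factorial : ℝ) * (j + 1).factorial)‖
      ≤ 1 ^ j / (j.factorial : ℝ) := by
  have h1 : |x / 2| ≤ 1 := by
    rw [abs_div, abs_two]; linarith
  have h2 : (1 : ℝ) ≤ (j + 1).factorial := by exact_mod_cast (Nat.factorial_pos _)
  have h3 : (0 : ℝ) < j.factorial := by exact_mod_cast (Nat.factorial_pos _)
  rw [norm_div, norm_mul, norm_pow, norm_neg, norm_one, one_pow, one_mul, norm_pow,
    Real.norm_eq_abs, Real.norm_of_nonneg (by positivity)]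
  have h4 : |x / 2| ^ (2 * j) ≤ 1 := pow_le_one₀ (abs_nonneg _) h1
  gcongr
  nlinarith

lemma abs_besselFactor_le {x : ℝ} (hx : |x| ≤ 2) : |besselFactor x| ≤ Real.exp 1 := by
  have hs := Real.summable_pow_div_factorial 1
  have : Real.exp 1 = ∑' j : ℕ, (1 : ℝ) ^ j / (j.factorial : ℝ) := by
    rw [Real.exp_eq_exp_ℝ, NormedSpace.exp_eq_tsum_div]
  rw [this]
  exact tsum_of_norm_bounded hs.hasSum (norm_besselFactor_term_le hx)

lemma tendsto_besselFactor : Tendsto besselFactor (𝓝 0) (𝓝 1) := by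
  have h0 : besselFactor 0 = 1 := by
    unfold besselFactor
    rw [tsum_eq_single 0]
    · simp
    · intro j hj
      simp [hj]
  rw [← h0]
  unfold besselFactor
  refine tendsto_tsum_of_dominated_convergence (Real.summable_pow_div_factorial 1) ?_ ?_
  · intro j
    exact (Continuous.tendsto (by fun_prop) 0)
  · have : ∀ᶠ x : ℝ in 𝓝 0, |x| < 2 := by
      have := (continuous_abs (G := ℝ)).tendsto 0
      rw [abs_zero] at this
      exact this.eventually (gt_mem_nhds (by norm_num))
    filter_upwards [this] with x hx j
    exact norm_besselFactor_term_le hx.le j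

/-- Termwise passage to the limit `r → 0⁺` in the series defining `B₄` and `B̃₄`. -/
lemma tendsto_bessel_series (n : ℕ) (P : ℕ → Prop) [DecidablePred P] (hP : ∀ c, P c → 0 < c)
    (K : ℝ → ℕ → ℂ) (b : ℕ → ℝ) (hb : Summable b) (hb0 : ∀ c, 0 ≤ b c)
    (hK : ∀ c, P c → Continuous fun t => K t c)
    (hKb : ∀ c, P c → ∀ t, 0 ≤ t → t ≤ 1 → ‖K t c‖ / (c : ℝ) ^ 2 ≤ b c) :
    Tendsto (fun r : ℝ => (π : ℂ) * ((Real.sqrt n / |r| : ℝ) : ℂ) *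
      ∑' c : ℕ, if P c then
        K (r ^ 2) c / (c : ℂ) * ((J1 (2 * π * |r| * Real.sqrt n / c) : ℝ) : ℂ) else 0)
      (𝓝[>] 0) (𝓝 ((π : ℂ) ^ 2 * n * ∑' c : ℕ, if P c then K 0 c / (c : ℂ) ^ 2 else 0)) := by
  have hev : ∀ᶠ r : ℝ in 𝓝[>] 0, 0 < r ∧ r ≤ 1 ∧ 2 * π * r * Real.sqrt n ≤ 2 := by
    have h1 : ∀ᶠ r : ℝ in 𝓝[>] 0, r < 1 :=
      nhdsWithin_le_nhds (gt_mem_nhds (by norm_num))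
    have h2 : ∀ᶠ r : ℝ in 𝓝[>] 0, 2 * π * r * Real.sqrt n < 2 := by
      have : Tendsto (fun r : ℝ => 2 * π * r * Real.sqrt n) (𝓝 0) (𝓝 (2 * π * 0 * Real.sqrt n)) :=
        Continuous.tendsto (by fun_prop) 0
      rw [mul_zero, zero_mul] at this
      exact nhdsWithin_le_nhds (this.eventually (gt_mem_nhds (by norm_num)))
    filter_upwards [h1, h2, self_mem_nhdsWithin] with r h1 h2 h3
    exact ⟨h3, h1.le, h2.le⟩
  have hsq : ((Real.sqrt n : ℝ) : ℂ) * ((Real.sqrt n : ℝ) : ℂ) = n := by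
    rw [← Complex.ofReal_mul, Real.mul_self_sqrt (Nat.cast_nonneg n)]
    simp
  have heq : ∀ᶠ r : ℝ in 𝓝[>] 0, (∑' c : ℕ, (π : ℂ) ^ 2 * n * (if P c then
        K (r ^ 2) c / (c : ℂ) ^ 2 * ((besselFactor (2 * π * r * Real.sqrt n / c) : ℝ) : ℂ) else 0))
      = (π : ℂ) * ((Real.sqrt n / |r| : ℝ) : ℂ) *
      ∑' c : ℕ, if P c then
        K (r ^ 2) c / (c : ℂ) * ((J1 (2 * π * |r| * Real.sqrt n / c) : ℝ) : ℂ) else 0 := by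
    filter_upwards [hev] with r hr
    rw [abs_of_pos hr.1, ← tsum_mul_left]
    refine tsum_congr fun c => ?_
    split_ifs with hc
    · have hc0 : (c : ℂ) ≠ 0 := by exact_mod_cast (hP c hc).ne'
      have hr0 : (r : ℂ) ≠ 0 := by exact_mod_cast hr.1.ne'
      rw [J1_eq, ← hsq]
      push_cast
      field_simp
    · simp
  refine Tendsto.congr' heq ?_
  rw [← tsum_mul_left]
  refine tendsto_tsum_of_dominated_convergence
    (bound := fun c => π ^ 2 * n * (b c * Real.exp 1)) ?_ ?_ ?_
  · exact (hb.mul_right _).mul_left _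
  · intro c
    refine Tendsto.const_mul _ ?_
    split_ifs with hc
    · have h1 : Tendsto (fun r : ℝ => K (r ^ 2) c) (𝓝[>] 0) (𝓝 (K 0 c)) := by
        have : Continuous fun r : ℝ => K (r ^ 2) c := (hK c hc).comp (continuous_pow 2)
        have h := this.tendsto 0
        simp only [ne_eq, OfNat.ofNat_ne_zero, not_false_eq_true, zero_pow] at h
        exact h.mono_left nhdsWithin_le_nhds
      have h2 : Tendsto (fun r : ℝ =>
          ((besselFactor (2 * π * r * Real.sqrt n / c) : ℝ) : ℂ)) (𝓝[>] 0) (𝓝 ((1 : ℝ) : ℂ)) := by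
        refine (Complex.continuous_ofReal.tendsto 1).comp (tendsto_besselFactor.comp ?_)
        have : Tendsto (fun r : ℝ => 2 * π * r * Real.sqrt n / c) (𝓝 0)
            (𝓝 (2 * π * 0 * Real.sqrt n / c)) := Continuous.tendsto (by fun_prop) 0
        rw [mul_zero, zero_mul, zero_div] at this
        exact this.mono_left nhdsWithin_le_nhds
      have := (h1.div_const ((c : ℂ) ^ 2)).mul h2
      simpa using this
    · exact tendsto_const_nhds
  · filter_upwards [hev] with r hr c
    obtain ⟨hr0, hr1, hr2⟩ := hr
    have hb' := hb0 c
    rw [norm_mul, norm_mul, norm_pow, Complex.norm_natCast, Complex.norm_real, Real.norm_eq_abs,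
      abs_of_pos Real.pi_pos]
    refine mul_le_mul_of_nonneg_left ?_ (by positivity)
    split_ifs with hc
    · have hc0 : (1 : ℝ) ≤ c := by exact_mod_cast hP c hc
      rw [norm_mul, norm_div, norm_pow, Complex.norm_natCast, Complex.norm_real, Real.norm_eq_abs]
      have h1 := hKb c hc (r ^ 2) (by positivity) (pow_le_one₀ hr0.le hr1)
      have h2 : |2 * π * r * Real.sqrt n / c| ≤ 2 := by
        have hpos : 0 ≤ 2 * π * r * Real.sqrt n := by positivity
        rw [abs_of_nonneg (by positivity)]
        exact (div_le_self hpos hc0).trans hr2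
      exact mul_le_mul h1 (abs_besselFactor_le h2) (abs_nonneg _) hb'
    · rw [norm_zero]
      positivity

/-- The Ramanujan sum `c_q(n)`, as a sum of `n`-th powers of primitive `q`-th roots of unity. -/
def ramanujanSum (n q : ℕ) : ℂ := ∑ ζ ∈ primitiveRoots q ℂ, ζ ^ n

lemma sum_units_stdAddChar_eq_ramanujanSum (n q : ℕ) [NeZero q] :
    ∑ u : (ZMod q)ˣ, (ZMod.stdAddChar ((n : ZMod q) * (u : ZMod q)) : ℂ) = ramanujanSum n q := by
  have hq : 0 < q := Nat.pos_of_ne_zero (NeZero.ne q)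
  unfold ramanujanSum
  refine Finset.sum_nbij (fun u : (ZMod q)ˣ => (ZMod.stdAddChar (u : ZMod q) : ℂ)) ?_ ?_ ?_ ?_
  · intro u _
    rw [mem_primitiveRoots hq]
    constructor
    · rw [← AddChar.map_nsmul_eq_pow]
      simp
    · intro l hl
      rw [← AddChar.map_nsmul_eq_pow, ← AddChar.map_zero_eq_one (ZMod.stdAddChar (N := q)),
        ZMod.injective_stdAddChar.eq_iff, nsmul_eq_mul, Units.mul_left_eq_zero,
        ZMod.natCast_eq_zero_iff] at hl
      exact hl
  · intro u _ v _ h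
    exact Units.ext (ZMod.injective_stdAddChar h)
  · intro ζ hζ
    rw [Finset.mem_coe, mem_primitiveRoots hq, Complex.isPrimitiveRoot_iff _ _ hq.ne'] at hζ
    obtain ⟨i, _, hi, rfl⟩ := hζ
    refine ⟨ZMod.unitOfCoprime i hi, Finset.mem_coe.mpr (Finset.mem_univ _), ?_⟩
    have := ZMod.stdAddChar_coe (N := q) (i : ℤ)
    simp only [ZMod.coe_unitOfCoprime]
    rw [← Int.cast_natCast (R := ZMod q), this]
    congr 1
    push_cast
    ring
  · intro u _
    rw [← AddChar.map_nsmul_eq_pow, nsmul_eq_mul]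

lemma sum_divisors_ramanujanSum (n q : ℕ) (hq : 0 < q) :
    ∑ d ∈ q.divisors, ramanujanSum n d = if q ∣ n then (q : ℂ) else 0 := by
  unfold ramanujanSum
  have hζ := Complex.isPrimitiveRoot_exp q hq.ne'
  set ζ₀ := Complex.exp (2 * π * Complex.I / q) with hζ₀
  rw [← Finset.sum_biUnion (fun a _ b _ hab => IsPrimitiveRoot.disjoint hab),
    ← IsPrimitiveRoot.nthRoots_one_eq_biUnion_primitiveRoots]
  split_ifs with h
  · obtain ⟨k, rfl⟩ := h
    rw [Finset.sum_congr rfl (g := fun _ => (1 : ℂ)), Finset.sum_const, hζ.card_nthRootsFinset]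
    · simp
    · intro x hx
      rw [Polynomial.mem_nthRootsFinset hq] at hx
      rw [pow_mul, hx, one_pow]
  · have hz0 : ζ₀ ≠ 0 := hζ.ne_zero hq.ne'
    have h1 : ∑ x ∈ Polynomial.nthRootsFinset q (1 : ℂ), x ^ n
        = ∑ x ∈ Polynomial.nthRootsFinset q (1 : ℂ), (ζ₀ * x) ^ n := by
      symm
      refine Finset.sum_nbij' (fun x => ζ₀ * x) (fun x => ζ₀⁻¹ * x) ?_ ?_ ?_ ?_ ?_
      · intro x hx
        rw [Polynomial.mem_nthRootsFinset hq] at *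
        rw [mul_pow, hx, hζ.pow_eq_one, one_mul]
      · intro x hx
        rw [Polynomial.mem_nthRootsFinset hq] at *
        rw [mul_pow, hx, inv_pow, hζ.pow_eq_one, inv_one, one_mul]
      · intro x _
        exact inv_mul_cancel_left₀ hz0 x
      · intro x _
        exact mul_inv_cancel_left₀ hz0 x
      · intro x _
        rfl
    simp only [mul_pow, ← Finset.mul_sum] at h1
    have h2 : ζ₀ ^ n ≠ 1 := by rwa [Ne, hζ.pow_eq_one_iff_dvd]
    have h3 : (ζ₀ ^ n - 1) * ∑ x ∈ Polynomial.nthRootsFinset q (1 : ℂ), x ^ n = 0 := by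
      rw [sub_mul, one_mul, ← h1, sub_self]
    exact (mul_eq_zero.mp h3).resolve_left (sub_ne_zero.mpr h2)

/-- The explicit evaluation `c_q(n) = ∑_{b ∣ (q, n)} μ(q / b) b`. -/
lemma ramanujanSum_eq (n q : ℕ) (hn : 0 < n) (hq : 0 < q) :
    ramanujanSum n q = ∑ b ∈ n.divisors,
      if b ∣ q then (ArithmeticFunction.moebius (q / b) : ℂ) * b else 0 := by
  have h := (ArithmeticFunction.sum_eq_iff_sum_mul_moebius_eq
    (f := ramanujanSum n) (g := fun q => if q ∣ n then (q : ℂ) else 0)).mp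
      (fun q hq => sum_divisors_ramanujanSum n q hq) q hq
  rw [← h, Nat.sum_divisorsAntidiagonal'
    (f := fun a b => ((ArithmeticFunction.moebius a : ℤ) : ℂ) * (if b ∣ n then (b : ℂ) else 0)),
    ← Finset.sum_filter]
  simp only [mul_ite, mul_zero]
  rw [← Finset.sum_filter]
  refine Finset.sum_congr ?_ fun _ _ => rfl
  ext b
  simp only [Finset.mem_filter, Nat.mem_divisors]
  constructor
  · rintro ⟨⟨h1, _⟩, h2⟩
    exact ⟨⟨h2, hn.ne'⟩, h1⟩
  · rintro ⟨⟨h1, _⟩, h2⟩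
    exact ⟨⟨h2, hq.ne'⟩, h1⟩

/-- The Dirichlet series `∑ μ(e) e⁻²` restricted to a set of integers. -/
def moebiusSeries (P : ℕ → Prop) [DecidablePred P] : ℂ :=
  ∑' e : ℕ, if P e then ((ArithmeticFunction.moebius e : ℤ) : ℂ) / (e : ℂ) ^ 2 else 0

lemma summable_moebius_div_sq (P : ℕ → Prop) [DecidablePred P] :
    Summable fun e : ℕ =>
      if P e then ((ArithmeticFunction.moebius e : ℤ) : ℂ) / (e : ℂ) ^ 2 else 0 := by
  refine Summable.of_norm_bounded (g := fun e : ℕ => 1 / (e : ℝ) ^ 2)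
    (Real.summable_one_div_nat_pow.mpr (by norm_num)) fun e => ?_
  split_ifs
  · rw [norm_div, norm_pow, Complex.norm_natCast]
    gcongr
    rw [Complex.norm_intCast]
    exact_mod_cast ArithmeticFunction.abs_moebius_le_one
  · rw [norm_zero]
    positivity

lemma moebiusSeries_true : moebiusSeries (fun _ => True) = 6 / (π : ℂ) ^ 2 := by
  have h := ArithmeticFunction.LSeries_zeta_mul_Lseries_moebius (s := 2) (by norm_num)
  rw [ArithmeticFunction.LSeries_zeta_eq_riemannZeta (by norm_num), riemannZeta_two] at h
  have h2 : LSeries (fun n => ((ArithmeticFunction.moebius n : ℤ) : ℂ)) 2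
      = moebiusSeries (fun _ => True) := by
    unfold LSeries moebiusSeries
    refine tsum_congr fun e => ?_
    rcases Nat.eq_zero_or_pos e with rfl | he
    · simp
    · rw [LSeries.term_of_ne_zero he.ne', if_pos trivial]
      norm_cast
  rw [h2] at h
  have hpi : (π : ℂ) ≠ 0 := by exact_mod_cast Real.pi_ne_zero
  field_simp at h ⊢
  linear_combination h

lemma moebius_two_mul (k : ℕ) : ArithmeticFunction.moebius (2 * k)
    = if Odd k then -ArithmeticFunction.moebius k else 0 := by
  split_ifs with h
  · rw [ArithmeticFunction.isMultiplicative_moebius.map_mul_of_coprime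
      (Nat.coprime_two_left.mpr h), ArithmeticFunction.moebius_apply_prime Nat.prime_two]
    ring
  · rw [Nat.not_odd_iff_even] at h
    obtain ⟨j, rfl⟩ := h
    refine ArithmeticFunction.moebius_eq_zero_of_not_squarefree fun hs => ?_
    have := hs 2 ⟨j, by ring⟩
    simp at this

lemma moebiusSeries_even :
    moebiusSeries (fun e => Even e) = -(moebiusSeries (fun e => Odd e)) / 4 := by
  unfold moebiusSeries
  have hinj : Function.Injective (fun k : ℕ => 2 * k) := fun a b h => by simpa using h
  rw [← hinj.tsum_eq, neg_div, div_eq_inv_mul, ← neg_mul, ← tsum_mul_left]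
  · refine tsum_congr fun k => ?_
    rw [if_pos (even_two_mul k), moebius_two_mul]
    split_ifs
    · push_cast
      ring
    · simp
  · intro e he
    rw [Function.mem_support] at he
    by_cases h : Even e
    · obtain ⟨k, rfl⟩ := h
      exact ⟨k, by ring⟩
    · simp [h] at he

lemma moebiusSeries_odd : moebiusSeries (fun e => Odd e) = 8 / (π : ℂ) ^ 2 := by
  have h : moebiusSeries (fun _ => True)
      = moebiusSeries (fun e => Even e) + moebiusSeries (fun e => Odd e) := by
    unfold moebiusSeries
    rw [← (summable_moebius_div_sq _).tsum_add (summable_moebius_div_sq _)]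
    refine tsum_congr fun e => ?_
    by_cases he : Even e
    · simp [he, Nat.not_odd_iff_even.mpr he]
    · simp [he, Nat.not_even_iff_odd.mp he]
  rw [moebiusSeries_true, moebiusSeries_even] at h
  linear_combination -(4 / 3 : ℂ) * h

/-- Sums of Ramanujan sums over a set of moduli, expressed through restricted Möbius series. -/
lemma tsum_ramanujanSum_div_sq (n : ℕ) (hn : 0 < n) (P : ℕ → Prop) [DecidablePred P]
    (hP : ∀ q, P q → 0 < q) :
    ∑' q : ℕ, (if P q then ramanujanSum n q / (q : ℂ) ^ 2 else 0)
      = ∑ b ∈ n.divisors, 1 / (b : ℂ) * moebiusSeries (fun e => P (b * e)) := by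
  have hterm : ∀ b ∈ n.divisors, HasSum (fun q : ℕ => if P q ∧ b ∣ q then
      ((ArithmeticFunction.moebius (q / b) : ℤ) : ℂ) * b / (q : ℂ) ^ 2 else 0)
      (1 / (b : ℂ) * moebiusSeries (fun e => P (b * e))) := by
    intro b hb
    have hb0 : 0 < b := Nat.pos_of_mem_divisors hb
    have hinj : Function.Injective (fun e : ℕ => b * e) :=
      fun x y h => Nat.eq_of_mul_eq_mul_left hb0 h
    rw [← hinj.hasSum_iff]
    · have h := ((summable_moebius_div_sq (fun e => P (b * e))).hasSum).mul_left (1 / (b : ℂ))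
      refine h.congr_fun ?_
      intro e
      have hb' : (b : ℂ) ≠ 0 := by exact_mod_cast hb0.ne'
      simp only [Function.comp_apply, dvd_mul_right, and_true, Nat.mul_div_cancel_left e hb0]
      split_ifs with hPe
      · have he' : (e : ℂ) ≠ 0 := by
          have := hP _ hPe
          exact_mod_cast (Nat.pos_of_mul_pos_left this).ne'
        push_cast
        field_simp
      · simp
    · intro q hq
      rw [if_neg]
      rintro ⟨_, k, rfl⟩
      exact hq ⟨k, rfl⟩
  rw [← (hasSum_sum hterm).tsum_eq]
  refine tsum_congr fun q => ?_
  split_ifs with hPq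
  · rw [ramanujanSum_eq n q hn (hP q hPq), Finset.sum_div]
    refine Finset.sum_congr rfl fun b _ => ?_
    simp only [hPq, true_and]
    split_ifs <;> simp
  · simp [hPq]

lemma realKloosterman_zero (n q : ℕ) [NeZero q] (f : (ZMod q)ˣ) :
    realKloosterman q ((n : ZMod q) * (f : ZMod q)) 0 = ramanujanSum n q := by
  rw [← sum_units_stdAddChar_eq_ramanujanSum]
  unfold realKloosterman
  refine Fintype.sum_equiv ((Equiv.inv _).trans (Equiv.mulLeft f)) _ _ fun u => ?_
  simp [ee, mul_assoc]

/-- The majorant of `|K(t, n, c, ν_Θ⁴)| / c²` used in passing to the limit. -/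
def kloostermanMajorant (q : ℕ) : ℝ := (q.divisors.card : ℝ) * (q : ℝ) ^ (7 / 8 : ℝ) / (q : ℝ) ^ 2

lemma kloostermanMajorant_nonneg (q : ℕ) : 0 ≤ kloostermanMajorant q := by
  unfold kloostermanMajorant
  positivity

lemma tendsto_B4 (n : ℕ) (hn : 0 < n) :
    Tendsto (B4 n) (𝓝[>] 0) (𝓝 ((π : ℂ) ^ 2 * n *
      ∑' c : ℕ, if Even c ∧ 0 < c then ramanujanSum n (2 * c) / (c : ℂ) ^ 2 else 0)) := by
  have hinj : Function.Injective fun c : ℕ => 2 * c := mul_right_injective₀ two_ne_zero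
  have h := tendsto_bessel_series n (fun c => Even c ∧ 0 < c) (fun c hc => hc.2)
    (fun t c => RKe t n c 4) (fun c => 4 * (84 * n) * kloostermanMajorant (2 * c))
    ((summable_card_divisors_mul_rpow.comp_injective hinj).mul_left _)
    (fun c => mul_nonneg (by positivity) (kloostermanMajorant_nonneg _)) ?_ ?_
  · have e : ∀ c : ℕ, (if Even c ∧ 0 < c then RKe 0 n c 4 / (c : ℂ) ^ 2 else 0)
        = if Even c ∧ 0 < c then ramanujanSum n (2 * c) / (c : ℂ) ^ 2 else 0 := by
      intro c
      refine if_ctx_congr Iff.rfl (fun hc => ?_) fun _ => rfl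
      have : NeZero (2 * c) := ⟨by omega⟩
      rw [RKe_four_eq 0 n c hc.1 hc.2, ← realKloosterman_zero n (2 * c) 1, Units.val_one, mul_one]
    simp only [e] at h
    exact h
  · rintro c ⟨hc, hc0⟩
    have : NeZero (2 * c) := ⟨by omega⟩
    simp only [RKe_four_eq _ n c hc hc0]
    exact continuous_realKloosterman _ _
  · rintro c ⟨hc, hc0⟩ t ht0 ht1
    have : NeZero (2 * c) := ⟨by omega⟩
    simp only [RKe_four_eq _ n c hc hc0]
    have h1 := norm_realKloosterman_le (2 * c) n n hn (fun x hx => hx) t ht0 ht1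
    have hc' : (0 : ℝ) < c := by exact_mod_cast hc0
    rw [div_le_iff₀ (by positivity)]
    refine h1.trans_eq ?_
    unfold kloostermanMajorant
    push_cast
    field_simp
    ring

lemma tendsto_B4t (n : ℕ) (hn : 0 < n) :
    Tendsto (B4t n) (𝓝[>] 0) (𝓝 ((π : ℂ) ^ 2 * n *
      ∑' c : ℕ, if Odd c then ramanujanSum n c / (c : ℂ) ^ 2 else 0)) := by
  have h := tendsto_bessel_series n (fun c => Odd c) (fun c hc => hc.pos)
    (fun t c => -RKo t n c 4) (fun c => 84 * n * kloostermanMajorant c)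
    (summable_card_divisors_mul_rpow.mul_left _)
    (fun c => mul_nonneg (by positivity) (kloostermanMajorant_nonneg _)) ?_ ?_
  · have e : ∀ c : ℕ, (if Odd c then -RKo 0 n c 4 / (c : ℂ) ^ 2 else 0)
        = if Odd c then ramanujanSum n c / (c : ℂ) ^ 2 else 0 := by
      intro c
      refine if_ctx_congr Iff.rfl (fun hc => ?_) fun _ => rfl
      have : NeZero c := ⟨hc.pos.ne'⟩
      rw [RKo_four_eq 0 n c hc, neg_neg, realKloosterman_zero]
    simp only [e] at h
    refine h.congr fun r => ?_
    unfold B4t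
    rw [neg_mul, neg_mul, ← mul_neg, ← tsum_neg]
    congr 1
    refine tsum_congr fun c => ?_
    split_ifs
    · ring
    · rw [neg_zero]
  · intro c hc
    have : NeZero c := ⟨hc.pos.ne'⟩
    simp only [RKo_four_eq _ n c hc, neg_neg]
    exact continuous_realKloosterman _ _
  · intro c hc t ht0 ht1
    have : NeZero c := ⟨hc.pos.ne'⟩
    simp only [RKo_four_eq _ n c hc, neg_neg]
    have h1 := norm_realKloosterman_le c
      ((n : ZMod c) * (((unitFour c hc)⁻¹ : (ZMod c)ˣ) : ZMod c)) n hn (fun x hx => ?_) t ht0 ht1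
    · have hc' : (0 : ℝ) < c := by exact_mod_cast hc.pos
      rw [div_le_iff₀ (by positivity)]
      refine h1.trans_eq ?_
      unfold kloostermanMajorant
      field_simp
    · have h2 := (unitFour c hc).mul_inv
      linear_combination ((unitFour c hc : (ZMod c)ˣ) : ZMod c) * hx - (n : ZMod c) * x * h2

lemma tsum_odd_ramanujanSum (n : ℕ) (hn : 0 < n) :
    (π : ℂ) ^ 2 * n * (∑' c : ℕ, if Odd c then ramanujanSum n c / (c : ℂ) ^ 2 else 0)
      = ∑ b ∈ n.divisors, if Odd b then 8 * ((n / b : ℕ) : ℂ) else 0 := by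
  have hpi : (π : ℂ) ≠ 0 := by exact_mod_cast Real.pi_ne_zero
  rw [tsum_ramanujanSum_div_sq n hn (fun c => Odd c) fun c hc => hc.pos, Finset.mul_sum]
  refine Finset.sum_congr rfl fun b hb => ?_
  have hbn := Nat.dvd_of_mem_divisors hb
  have hb0 : (b : ℂ) ≠ 0 := by exact_mod_cast (Nat.pos_of_mem_divisors hb).ne'
  rw [Nat.cast_div hbn hb0]
  split_ifs with h
  · have : moebiusSeries (fun e => Odd (b * e)) = 8 / (π : ℂ) ^ 2 := by
      rw [← moebiusSeries_odd]
      unfold moebiusSeries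
      simp [Nat.odd_mul, h]
    rw [this]
    field_simp
  · have : moebiusSeries (fun e => Odd (b * e)) = 0 := by
      unfold moebiusSeries
      simp [Nat.odd_mul, h]
    rw [this]
    simp

lemma moebiusSeries_four_dvd_mul {b : ℕ} (hb : 0 < b) :
    moebiusSeries (fun e => 4 ∣ b * e ∧ 0 < b * e)
      = if 4 ∣ b then 6 / (π : ℂ) ^ 2 else if 2 ∣ b then -2 / (π : ℂ) ^ 2 else 0 := by
  have hz : ∀ e : ℕ, 4 ∣ e → ArithmeticFunction.moebius e = 0 := by
    intro e he
    refine ArithmeticFunction.moebius_eq_zero_of_not_squarefree fun hs => ?_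
    have := hs 2 he
    norm_num at this
  have key : ∀ e : ℕ, 0 < e → (4 ∣ b * e ∧ 0 < b * e ↔ 4 ∣ b * e) := fun e he =>
    and_iff_left (Nat.mul_pos hb he)
  split_ifs with h4 h2
  · rw [← moebiusSeries_true]
    unfold moebiusSeries
    refine tsum_congr fun e => ?_
    rcases Nat.eq_zero_or_pos e with rfl | he
    · simp
    · rw [if_pos ((key e he).mpr (h4.mul_right e)), if_pos trivial]
  · have e1 : moebiusSeries (fun e => 4 ∣ b * e ∧ 0 < b * e) = moebiusSeries (fun e => Even e) := by
      unfold moebiusSeries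
      refine tsum_congr fun e => ?_
      rcases Nat.eq_zero_or_pos e with rfl | he
      · simp
      · refine if_congr ((key e he).trans ?_) rfl rfl
        change _ ↔ Even e
        obtain ⟨k, rfl⟩ := h2
        rw [show 4 = 2 * 2 by norm_num, mul_assoc, Nat.mul_dvd_mul_iff_left two_pos,
          Nat.prime_two.dvd_mul, even_iff_two_dvd]
        refine or_iff_right fun hk => h4 ?_
        exact Nat.mul_dvd_mul_left 2 hk
    rw [e1, moebiusSeries_even, moebiusSeries_odd]
    ring
  · unfold moebiusSeries
    refine (tsum_congr fun e => ?_).trans tsum_zero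
    split_ifs with h
    · have hco : Nat.Coprime 4 b := by
        rw [show 4 = 2 ^ 2 by norm_num]
        exact Nat.Coprime.pow_left 2 ((Nat.prime_two.coprime_iff_not_dvd).mpr h2)
      rw [hz e (hco.dvd_of_dvd_mul_left h.1)]
      simp
    · rfl

lemma tsum_even_ramanujanSum (n : ℕ) (hn : 0 < n) :
    (π : ℂ) ^ 2 * n *
      (∑' c : ℕ, if Even c ∧ 0 < c then ramanujanSum n (2 * c) / (c : ℂ) ^ 2 else 0)
      = ∑ b ∈ n.divisors, if 4 ∣ b then 24 * ((n / b : ℕ) : ℂ)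
          else if 2 ∣ b then -8 * ((n / b : ℕ) : ℂ) else 0 := by
  have hpi : (π : ℂ) ≠ 0 := by exact_mod_cast Real.pi_ne_zero
  have hinj : Function.Injective fun c : ℕ => 2 * c := mul_right_injective₀ two_ne_zero
  have e1 : (∑' c : ℕ, if Even c ∧ 0 < c then ramanujanSum n (2 * c) / (c : ℂ) ^ 2 else 0)
      = 4 * ∑' q : ℕ, if 4 ∣ q ∧ 0 < q then ramanujanSum n q / (q : ℂ) ^ 2 else 0 := by
    rw [← hinj.tsum_eq (f := fun q : ℕ =>
      if 4 ∣ q ∧ 0 < q then ramanujanSum n q / (q : ℂ) ^ 2 else 0), ← tsum_mul_left]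
    · refine tsum_congr fun c => ?_
      have h4 : 4 ∣ 2 * c ∧ 0 < 2 * c ↔ Even c ∧ 0 < c := by
        rw [even_iff_two_dvd]; omega
      simp only [h4]
      split_ifs
      · push_cast
        ring
      · simp
    · intro q hq
      obtain ⟨k, hk⟩ : 4 ∣ q := by
        by_contra h
        simp [h] at hq
      exact ⟨2 * k, by simp only; omega⟩
  rw [e1, tsum_ramanujanSum_div_sq n hn (fun q => 4 ∣ q ∧ 0 < q) fun q hq => hq.2,
    Finset.mul_sum, Finset.mul_sum]
  refine Finset.sum_congr rfl fun b hb => ?_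
  have hbn := Nat.dvd_of_mem_divisors hb
  have hb0 : (b : ℂ) ≠ 0 := by exact_mod_cast (Nat.pos_of_mem_divisors hb).ne'
  rw [Nat.cast_div hbn hb0, moebiusSeries_four_dvd_mul (Nat.pos_of_mem_divisors hb)]
  split_ifs
  · field_simp
    ring
  · field_simp
    ring
  · simp

lemma sum_odd_divisors (h m : ℕ) (hm : Odd m) :
    ∑ b ∈ (2 ^ h * m).divisors with Odd b, 2 ^ h * m / b = 2 ^ h * sigma1 m := by
  have : {b ∈ (2 ^ h * m).divisors | Odd b} = m.divisors := by
    ext b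
    have hm0 := hm.pos.ne'
    simp only [Finset.mem_filter, Nat.mem_divisors]
    constructor
    · rintro ⟨⟨hb, -⟩, ho⟩
      exact ⟨Nat.Coprime.dvd_of_dvd_mul_left (ho.coprime_two_right.pow_right h) hb, hm0⟩
    · rintro ⟨hb, -⟩
      exact ⟨⟨hb.mul_left _, by positivity⟩, hm.of_dvd_nat hb⟩
  rw [this, sigma1, ← Nat.sum_div_divisors m fun d => d, Finset.mul_sum]
  exact Finset.sum_congr rfl fun b hb => Nat.mul_div_assoc _ (Nat.dvd_of_mem_divisors hb)

lemma sum_two_mod_four_divisors (h m : ℕ) (hm : Odd m) :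
    ∑ b ∈ (2 ^ (h + 1) * m).divisors with ¬ 4 ∣ b ∧ 2 ∣ b, 2 ^ (h + 1) * m / b
      = 2 ^ h * sigma1 m := by
  rw [← sum_odd_divisors h m hm]
  symm
  refine Finset.sum_nbij (fun b => 2 * b) ?_ ?_ ?_ ?_
  · intro b hb
    simp only [Finset.mem_filter, Nat.mem_divisors] at hb ⊢
    obtain ⟨⟨hb, h0⟩, ho⟩ := hb
    refine ⟨⟨?_, ?_⟩, ?_, dvd_mul_right _ _⟩
    · rw [pow_succ', mul_assoc]
      exact Nat.mul_dvd_mul_left 2 hb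
    · rw [pow_succ', mul_assoc]
      exact mul_ne_zero two_ne_zero h0
    · obtain ⟨k, rfl⟩ := ho
      omega
  · intro a _ b _ hab
    simp only at hab
    omega
  · intro b hb
    simp only [Finset.coe_filter, Set.mem_ofPred_eq, Nat.mem_divisors] at hb
    obtain ⟨⟨hb, h0⟩, h4, k, rfl⟩ := hb
    refine ⟨k, ?_, rfl⟩
    rw [pow_succ', mul_assoc] at hb h0
    simp only [Finset.coe_filter, Set.mem_ofPred_eq, Nat.mem_divisors]
    refine ⟨⟨Nat.dvd_of_mul_dvd_mul_left two_pos hb, right_ne_zero_of_mul h0⟩, ?_⟩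
    rw [← Nat.not_even_iff_odd]
    rintro ⟨j, rfl⟩
    omega
  · intro b _
    rw [pow_succ', mul_assoc, Nat.mul_div_mul_left _ _ two_pos]

lemma sigma1_two_pow_mul (h m : ℕ) (hm : Odd m) :
    (sigma1 (2 ^ h * m) : ℂ) = (2 ^ (h + 1) - 1) * sigma1 m := by
  have h1 : sigma1 (2 ^ h * m) = (∑ i ∈ Finset.range (h + 1), 2 ^ i) * sigma1 m := by
    unfold sigma1
    rw [Nat.Coprime.sum_divisors_mul (hm.coprime_two_left.pow_left h),
      Nat.sum_divisors_prime_pow Nat.prime_two]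
  rw [h1]
  push_cast
  rw [geom_sum_eq (by norm_num)]
  norm_num

lemma exists_eq_two_pow_padicValNat_mul (n : ℕ) (hn : 0 < n) :
    ∃ m, Odd m ∧ n = 2 ^ padicValNat 2 n * m := by
  obtain ⟨h, m, hm, rfl⟩ := Nat.exists_eq_two_pow_mul_odd hn.ne'
  refine ⟨m, hm, ?_⟩
  rw [padicValNat.mul (by positivity) hm.pos.ne', padicValNat.prime_pow,
    padicValNat.eq_zero_of_not_dvd (by rwa [← even_iff_two_dvd, Nat.not_even_iff_odd]), add_zero]

lemma two_pow_succ_sub_one_ne_zero (h : ℕ) : (2 : ℂ) ^ (h + 1) - 1 ≠ 0 := by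
  have : (1 : ℝ) < 2 ^ (h + 1) := one_lt_pow₀ one_lt_two h.succ_ne_zero
  exact_mod_cast (sub_pos.mpr this).ne'

lemma sum_ite_odd_divisors (n : ℕ) (hn : 0 < n) :
    ∑ b ∈ n.divisors, (if Odd b then 8 * ((n / b : ℕ) : ℂ) else 0)
      = 8 * sigma1 n * 2 ^ padicValNat 2 n / (2 ^ (padicValNat 2 n + 1) - 1) := by
  obtain ⟨m, hm, he⟩ := exists_eq_two_pow_padicValNat_mul n hn
  generalize padicValNat 2 n = h at *
  subst he
  have h0 := two_pow_succ_sub_one_ne_zero h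
  rw [← Finset.sum_filter, ← Finset.mul_sum, ← Nat.cast_sum, sum_odd_divisors h m hm,
    sigma1_two_pow_mul h m hm]
  push_cast
  field_simp

lemma sum_ite_four_dvd_divisors (n : ℕ) (hn : 0 < n) (hev : Even n) :
    ∑ b ∈ n.divisors, (if 4 ∣ b then 24 * ((n / b : ℕ) : ℂ)
        else if 2 ∣ b then -8 * ((n / b : ℕ) : ℂ) else 0)
      = 8 * sigma1 n * (2 ^ padicValNat 2 n - 3) / (2 ^ (padicValNat 2 n + 1) - 1) := by
  have hsplit : ∑ b ∈ n.divisors, (if 4 ∣ b then 24 * ((n / b : ℕ) : ℂ)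
        else if 2 ∣ b then -8 * ((n / b : ℕ) : ℂ) else 0)
      = 24 * sigma1 n - 24 * ((∑ b ∈ n.divisors with Odd b, n / b : ℕ) : ℂ)
        - 32 * ((∑ b ∈ n.divisors with ¬ 4 ∣ b ∧ 2 ∣ b, n / b : ℕ) : ℂ) := by
    rw [sigma1, ← Nat.sum_div_divisors n fun d => d, Finset.sum_filter, Finset.sum_filter]
    push_cast
    simp only [Finset.mul_sum, ← Finset.sum_sub_distrib]
    refine Finset.sum_congr rfl fun b _ => ?_
    by_cases h4 : 4 ∣ b
    · have ho : ¬ Odd b := by rw [Nat.not_odd_iff_even, even_iff_two_dvd]; omega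
      simp [h4, ho]
    · by_cases h2 : 2 ∣ b
      · have ho : ¬ Odd b := by rw [Nat.not_odd_iff_even, even_iff_two_dvd]; exact h2
        simp only [h4, h2, ho, not_false_eq_true, and_self, if_true, if_false]
        ring
      · have ho : Odd b := by rw [← Nat.not_even_iff_odd, even_iff_two_dvd]; exact h2
        simp [h4, h2, ho]
  rw [hsplit]
  obtain ⟨m, hm, he⟩ := exists_eq_two_pow_padicValNat_mul n hn
  generalize padicValNat 2 n = h at *
  subst he
  obtain - | h := h
  · rw [pow_zero, one_mul, ← Nat.not_odd_iff_even] at hev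
    exact absurd hm hev
  have h0 := two_pow_succ_sub_one_ne_zero (h + 1)
  rw [sum_odd_divisors (h + 1) m hm, sum_two_mod_four_divisors h m hm,
    sigma1_two_pow_mul (h + 1) m hm]
  push_cast
  rw [eq_div_iff h0]
  ring

lemma sum_ite_four_dvd_divisors_of_odd (n : ℕ) (hodd : Odd n) :
    ∑ b ∈ n.divisors, (if 4 ∣ b then 24 * ((n / b : ℕ) : ℂ)
        else if 2 ∣ b then -8 * ((n / b : ℕ) : ℂ) else 0) = 0 := by
  refine Finset.sum_eq_zero fun b hb => ?_
  obtain ⟨k, hk⟩ := hodd.of_dvd_nat (Nat.dvd_of_mem_divisors hb)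
  rw [if_neg (by omega), if_neg (by omega)]

/-- **Theorem 1.2(3)**: values of `B_{4,n}` and `B̃_{4,n}` at `r = 0⁺`.  With `h = ν₂(n)`:
if `n` is even then `B_{4,n}(r) → 8σ₁(n)(2^h − 3)/(2^{h+1} − 1)` as `r → 0⁺`, if `n` is odd
then `B_{4,n}(r) → 0`, and in all cases `B̃_{4,n}(r) → 8σ₁(n)·2^h/(2^{h+1} − 1)`. -/
theorem B4_values_at_zero (n : ℕ) (hn : 1 ≤ n) :
    (Even n →
      Filter.Tendsto (fun r : ℝ => B4 n r) (nhdsWithin 0 (Set.Ioi 0))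
        (nhds (((8 * (sigma1 n : ℝ) * ((2 : ℝ) ^ (padicValNat 2 n) - 3) /
          ((2 : ℝ) ^ (padicValNat 2 n + 1) - 1) : ℝ) : ℂ)))) ∧
    (Odd n →
      Filter.Tendsto (fun r : ℝ => B4 n r) (nhdsWithin 0 (Set.Ioi 0)) (nhds 0)) ∧
    Filter.Tendsto (fun r : ℝ => B4t n r) (nhdsWithin 0 (Set.Ioi 0))
      (nhds (((8 * (sigma1 n : ℝ) * (2 : ℝ) ^ (padicValNat 2 n) /
        ((2 : ℝ) ^ (padicValNat 2 n + 1) - 1) : ℝ) : ℂ))) := by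
  have h1 := tendsto_B4 n hn
  rw [tsum_even_ramanujanSum n hn] at h1
  have h2 := tendsto_B4t n hn
  rw [tsum_odd_ramanujanSum n hn, sum_ite_odd_divisors n hn] at h2
  refine ⟨fun hev => ?_, fun hodd => ?_, ?_⟩
  · rw [sum_ite_four_dvd_divisors n hn hev] at h1
    exact_mod_cast h1
  · rwa [sum_ite_four_dvd_divisors_of_odd n hodd] at h1
  · exact_mod_cast h2

end
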